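/- Let K and L be finite simplicial complexes such that one of Ẽ_1^{*,*}(K), Ẽ_1^{*,*}(L) is torsion free and one of 𝓗̃^{*,*}(K), 𝓗̃^{*,*}(L) is torsion free. Then Σ^{-1}𝓗̃^{*,*}(K * L) ≅ 𝓗̃^{*,*}(K) ⊗ 𝓗̃^{*,*}(L), where Σ^{-1} lowers bidegree by (1,1) and K*L is the join. -/

import Mathlib

open Finset

/-- A finite abstract simplicial complex with vertices in `ℕ`. -/
structure SC where
  faces : Finset (Finset ℕ)
  down_closed : ∀ ⦃s t : Finset ℕ⦄, s ∈ faces → t ⊆ s → t ∈ faces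

namespace SC

/-- The vertex set of a simplicial complex. -/
def verts (K : SC) : Finset ℕ := K.faces.sup id

/-- The dimension of a simplicial complex (dimension of `{∅}` is `-1`). -/
def dim (K : SC) : ℤ := ((K.faces.sup Finset.card : ℕ) : ℤ) - 1

/-- The link of a simplex. -/
def link (K : SC) (σ : Finset ℕ) : SC where
  faces := K.faces.filter fun t => σ ∪ t ∈ K.faces ∧ Disjoint σ t
  down_closed := by
    intro s t hs hts
    simp only [mem_filter] at hs ⊢
    refine ⟨K.down_closed hs.1 hts, K.down_closed hs.2.1 (union_subset_union_right hts),
      hs.2.2.mono_right ?_⟩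
    exact_mod_cast hts

/-- `K₁` is a subcomplex of `K`. -/
def IsSub (K₁ K : SC) : Prop := K₁.faces ⊆ K.faces

/-- Union of two simplicial complexes. -/
def union (K L : SC) : SC where
  faces := K.faces ∪ L.faces
  down_closed := by
    intro s t hs hts
    rcases mem_union.mp hs with h | h
    · exact mem_union_left _ (K.down_closed h hts)
    · exact mem_union_right _ (L.down_closed h hts)

/-- Intersection of two simplicial complexes. -/
def inter (K L : SC) : SC where
  faces := K.faces ∩ L.faces
  down_closed := by
    intro s t hs hts
    rw [mem_inter] at hs ⊢
    exact ⟨K.down_closed hs.1 hts, L.down_closed hs.2 hts⟩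

/-- The join of two simplicial complexes. -/
def join (K L : SC) : SC where
  faces := (K.faces ×ˢ L.faces).image fun x => x.1 ∪ x.2
  down_closed := by
    intro s t hs hts
    simp only [mem_image, mem_product] at hs ⊢
    obtain ⟨⟨a, b⟩, ⟨ha, hb⟩, rfl⟩ := hs
    refine ⟨⟨t ∩ a, t \ a⟩, ⟨K.down_closed ha inter_subset_right,
      L.down_closed hb fun x hx => ?_⟩, ?_⟩
    · rcases mem_union.mp (hts (mem_sdiff.mp hx).1) with h | h
      · exact absurd h (mem_sdiff.mp hx).2
      · exact h
    · ext x
      simp only [mem_union, mem_inter, mem_sdiff]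
      constructor
      · rintro (⟨h, _⟩ | ⟨h, _⟩) <;> exact h
      · intro hx
        by_cases hxa : x ∈ a
        · exact Or.inl ⟨hx, hxa⟩
        · exact Or.inr ⟨hx, hxa⟩

end SC
namespace SC
open Finset

/-- The sign of a vertex `v` in a simplex, given by its position in the canonical ordering. -/
def psgn (v : ℕ) (s : Finset ℕ) : ℤ := (-1) ^ (s.filter fun u => u < v).card

variable (G : Type) [AddCommGroup G]

/-- The submodule of functions supported on a given set of indices. -/
def suppM {α : Type} (P : α → Prop) : Submodule ℤ (α → G) where
  carrier := {c | ∀ x, c x ≠ 0 → P x}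
  add_mem' := by
    intro a b ha hb x hx
    by_cases h : a x = 0
    · exact hb x (by simpa [h] using hx)
    · exact ha x h
  zero_mem' := fun x hx => absurd rfl hx
  smul_mem' := by
    intro z a ha x hx
    exact ha x fun h => hx (by simp [h])

end SC
namespace SC
open Finset

/-- Pairs of simplices, indexing the double complex `N^{*,*}`. -/
abbrev Pr := Finset ℕ × Finset ℕ

variable (G : Type) [AddCommGroup G]

/-- The `(p,q)`-graded piece of the double complex `N^{*,*}(K)` spanned by `σ ⊗ τ`, `σ ⊆ τ`. -/
def Ngr (K : SC) (p q : ℤ) : Submodule ℤ (Pr → G) :=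
  suppM G fun x => x.1 ⊆ x.2 ∧ x.2 ∈ K.faces ∧ x.1 ≠ ∅ ∧
    (x.1.card : ℤ) = p + 1 ∧ (x.2.card : ℤ) = q + 1

/-- The `(p,q)`-graded piece of the reduced double complex `Ñ^{*,*}(K)`. -/
def NgrR (K : SC) (p q : ℤ) : Submodule ℤ (Pr → G) :=
  suppM G fun x => x.1 ⊆ x.2 ∧ x.2 ∈ K.faces ∧
    (x.1.card : ℤ) = p + 1 ∧ (x.2.card : ℤ) = q + 1

/-- The vertical differential `σ ⊗ τ ↦ (-1)^{|σ|} σ ⊗ δτ` (unreduced). -/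
def dvF (K : SC) (c : Pr → G) : Pr → G := fun x =>
  if x.2 ∈ K.faces ∧ x.1 ⊆ x.2 ∧ x.1 ≠ ∅ then
    ((-1 : ℤ) ^ x.1.card) •
      ∑ w ∈ x.2, if x.1 ⊆ x.2.erase w then psgn w x.2 • c (x.1, x.2.erase w) else 0
  else 0

/-- The horizontal differential `σ ⊗ τ ↦ dσ ⊗ τ` (unreduced). -/
def dhF (K : SC) (c : Pr → G) : Pr → G := fun x =>
  if x.2 ∈ K.faces ∧ x.1 ⊆ x.2 ∧ x.1 ≠ ∅ then
    ∑ v ∈ x.2 \ x.1, psgn v (insert v x.1) • c (insert v x.1, x.2)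
  else 0

/-- The vertical differential (reduced). -/
def dvRF (K : SC) (c : Pr → G) : Pr → G := fun x =>
  if x.2 ∈ K.faces ∧ x.1 ⊆ x.2 then
    ((-1 : ℤ) ^ x.1.card) •
      ∑ w ∈ x.2, if x.1 ⊆ x.2.erase w then psgn w x.2 • c (x.1, x.2.erase w) else 0
  else 0

/-- The horizontal differential (reduced). -/
def dhRF (K : SC) (c : Pr → G) : Pr → G := fun x =>
  if x.2 ∈ K.faces ∧ x.1 ⊆ x.2 then
    ∑ v ∈ x.2 \ x.1, psgn v (insert v x.1) • c (insert v x.1, x.2)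
  else 0

/-- The vertical differential as a linear map (unreduced). -/
def dvL (K : SC) : (Pr → G) →ₗ[ℤ] (Pr → G) where
  toFun := dvF G K
  map_add' := by
    intro a b
    funext x
    simp only [dvF, Pi.add_apply]
    split_ifs with h
    · rw [← smul_add, ← Finset.sum_add_distrib]
      congr 1
      refine Finset.sum_congr rfl fun w _ => ?_
      split_ifs with h2
      · simp [smul_add]
      · simp
    · simp
  map_smul' := by
    intro z a
    funext x
    simp only [dvF, Pi.smul_apply, RingHom.id_apply]
    split_ifs with h
    · rw [smul_comm z]
      congr 1
      rw [Finset.smul_sum]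
      refine Finset.sum_congr rfl fun w _ => ?_
      split_ifs with h2
      · rw [smul_smul, smul_smul, mul_comm]
      · simp
    · simp

/-- The horizontal differential as a linear map (unreduced). -/
def dhL (K : SC) : (Pr → G) →ₗ[ℤ] (Pr → G) where
  toFun := dhF G K
  map_add' := by
    intro a b
    funext x
    simp only [dhF, Pi.add_apply]
    split_ifs with h
    · rw [← Finset.sum_add_distrib]
      exact Finset.sum_congr rfl fun v _ => smul_add _ _ _
    · simp
  map_smul' := by
    intro z a
    funext x
    simp only [dhF, Pi.smul_apply, RingHom.id_apply]
    split_ifs with h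
    · rw [Finset.smul_sum]
      refine Finset.sum_congr rfl fun v _ => ?_
      rw [smul_smul, smul_smul, mul_comm]
    · simp

/-- The vertical differential as a linear map (reduced). -/
def dvRL (K : SC) : (Pr → G) →ₗ[ℤ] (Pr → G) where
  toFun := dvRF G K
  map_add' := by
    intro a b
    funext x
    simp only [dvRF, Pi.add_apply]
    split_ifs with h
    · rw [← smul_add, ← Finset.sum_add_distrib]
      congr 1
      refine Finset.sum_congr rfl fun w _ => ?_
      split_ifs with h2
      · simp [smul_add]
      · simp
    · simp
  map_smul' := by
    intro z a
    funext x
    simp only [dvRF, Pi.smul_apply, RingHom.id_apply]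
    split_ifs with h
    · rw [smul_comm z]
      congr 1
      rw [Finset.smul_sum]
      refine Finset.sum_congr rfl fun w _ => ?_
      split_ifs with h2
      · rw [smul_smul, smul_smul, mul_comm]
      · simp
    · simp

/-- The horizontal differential as a linear map (reduced). -/
def dhRL (K : SC) : (Pr → G) →ₗ[ℤ] (Pr → G) where
  toFun := dhRF G K
  map_add' := by
    intro a b
    funext x
    simp only [dhRF, Pi.add_apply]
    split_ifs with h
    · rw [← Finset.sum_add_distrib]
      exact Finset.sum_congr rfl fun v _ => smul_add _ _ _
    · simp
  map_smul' := by
    intro z a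
    funext x
    simp only [dhRF, Pi.smul_apply, RingHom.id_apply]
    split_ifs with h
    · rw [Finset.smul_sum]
      refine Finset.sum_congr rfl fun v _ => ?_
      rw [smul_smul, smul_smul, mul_comm]
    · simp

/-- The total differential `Δ(σ⊗τ) = dσ⊗τ + (-1)^{|σ|}σ⊗δτ` (unreduced). -/
def dL (K : SC) : (Pr → G) →ₗ[ℤ] (Pr → G) := dhL G K + dvL G K

/-- The total differential (reduced). -/
def dRL (K : SC) : (Pr → G) →ₗ[ℤ] (Pr → G) := dhRL G K + dvRL G K

/-- Cocycles for the `E₁`-page: `ker Δ_v` in bidegree `(p,q)`. -/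
def Z1 (K : SC) (p q : ℤ) : Submodule ℤ (Pr → G) :=
  Ngr G K p q ⊓ LinearMap.ker (dvL G K)

/-- Coboundaries for the `E₁`-page. -/
def B1 (K : SC) (p q : ℤ) : Submodule ℤ (Pr → G) :=
  Submodule.map (dvL G K) (Ngr G K p (q - 1)) ⊓ Ngr G K p q

/-- The `E₁`-page of the cohomeology spectral sequence in bidegree `(p,q)`. -/
abbrev E1 (K : SC) (p q : ℤ) :=
  ↥(Z1 G K p q) ⧸ Submodule.comap (Z1 G K p q).subtype (B1 G K p q)

/-- Reduced `E₁`-cocycles. -/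
def Z1R (K : SC) (p q : ℤ) : Submodule ℤ (Pr → G) :=
  NgrR G K p q ⊓ LinearMap.ker (dvRL G K)

/-- Reduced `E₁`-coboundaries. -/
def B1R (K : SC) (p q : ℤ) : Submodule ℤ (Pr → G) :=
  Submodule.map (dvRL G K) (NgrR G K p (q - 1)) ⊓ NgrR G K p q

/-- The `E₁`-page of the reduced cohomeology spectral sequence. -/
abbrev E1R (K : SC) (p q : ℤ) :=
  ↥(Z1R G K p q) ⧸ Submodule.comap (Z1R G K p q).subtype (B1R G K p q)

/-- `E₂`-cocycles: vertical cocycles whose horizontal differential is a vertical coboundary. -/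
def Z2 (K : SC) (p q : ℤ) : Submodule ℤ (Pr → G) :=
  Ngr G K p q ⊓ LinearMap.ker (dvL G K) ⊓
    Submodule.comap (dhL G K) (Submodule.map (dvL G K) (Ngr G K (p - 1) (q - 1)))

/-- `E₂`-coboundaries. -/
def B2 (K : SC) (p q : ℤ) : Submodule ℤ (Pr → G) :=
  (Submodule.map (dvL G K) (Ngr G K p (q - 1)) ⊔
    Submodule.map (dhL G K) (Ngr G K (p + 1) q ⊓ LinearMap.ker (dvL G K))) ⊓ Ngr G K p q

/-- The cohomeology group `𝓗^{p,q}(K; G)`: the `E₂`-page of the cohomeology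
spectral sequence in bidegree `(p,q)`. -/
abbrev HH (K : SC) (p q : ℤ) :=
  ↥(Z2 G K p q) ⧸ Submodule.comap (Z2 G K p q).subtype (B2 G K p q)

/-- Reduced `E₂`-cocycles. -/
def Z2R (K : SC) (p q : ℤ) : Submodule ℤ (Pr → G) :=
  NgrR G K p q ⊓ LinearMap.ker (dvRL G K) ⊓
    Submodule.comap (dhRL G K) (Submodule.map (dvRL G K) (NgrR G K (p - 1) (q - 1)))

/-- Reduced `E₂`-coboundaries. -/
def B2R (K : SC) (p q : ℤ) : Submodule ℤ (Pr → G) :=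
  (Submodule.map (dvRL G K) (NgrR G K p (q - 1)) ⊔
    Submodule.map (dhRL G K) (NgrR G K (p + 1) q ⊓ LinearMap.ker (dvRL G K))) ⊓ NgrR G K p q

/-- The reduced cohomeology group `𝓗̃^{p,q}(K; G)`. -/
abbrev HHR (K : SC) (p q : ℤ) :=
  ↥(Z2R G K p q) ⧸ Submodule.comap (Z2R G K p q).subtype (B2R G K p q)

/-- Total-degree-`n` part of the total complex of `N^{*,*}(K)`. -/
def Tgr (K : SC) (n : ℤ) : Submodule ℤ (Pr → G) :=
  suppM G fun x => x.1 ⊆ x.2 ∧ x.2 ∈ K.faces ∧ x.1 ≠ ∅ ∧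
    (x.2.card : ℤ) - (x.1.card : ℤ) = n

/-- Total-degree-`n` part of the total complex of `Ñ^{*,*}(K)`. -/
def TgrR (K : SC) (n : ℤ) : Submodule ℤ (Pr → G) :=
  suppM G fun x => x.1 ⊆ x.2 ∧ x.2 ∈ K.faces ∧
    (x.2.card : ℤ) - (x.1.card : ℤ) = n

/-- The degree-`n` cohomology of the total complex of `N^{*,*}(K)`. -/
abbrev TotH (K : SC) (n : ℤ) :=
  ↥(Tgr G K n ⊓ LinearMap.ker (dL G K)) ⧸
    Submodule.comap (Tgr G K n ⊓ LinearMap.ker (dL G K)).subtype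
      (Submodule.map (dL G K) (Tgr G K (n - 1)) ⊓ Tgr G K n)

/-- The degree-`n` cohomology of the total complex of `Ñ^{*,*}(K)`. -/
abbrev TotHR (K : SC) (n : ℤ) :=
  ↥(TgrR G K n ⊓ LinearMap.ker (dRL G K)) ⧸
    Submodule.comap (TgrR G K n ⊓ LinearMap.ker (dRL G K)).subtype
      (Submodule.map (dRL G K) (TgrR G K (n - 1)) ⊓ TgrR G K n)

/-- The filtration `F^p` of the total complex by first degree. -/
def Fil (p : ℤ) : Submodule ℤ (Pr → G) :=
  suppM G fun x => (x.1.card : ℤ) ≤ p + 1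

/-- The `E_∞`-term of the cohomeology spectral sequence in bidegree `(p,p)`:
the `p`-th graded piece of the filtration induced on `H^0` of the total complex. -/
abbrev Einf0 (K : SC) (p : ℤ) :=
  ↥(Tgr ℤ K 0 ⊓ LinearMap.ker (dL ℤ K) ⊓ Fil ℤ p) ⧸
    Submodule.comap (Tgr ℤ K 0 ⊓ LinearMap.ker (dL ℤ K) ⊓ Fil ℤ p).subtype
      ((Tgr ℤ K 0 ⊓ LinearMap.ker (dL ℤ K) ⊓ Fil ℤ (p - 1)) ⊔
        (Submodule.map (dL ℤ K) (Tgr ℤ K (-1)) ⊓ Tgr ℤ K 0 ⊓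
          LinearMap.ker (dL ℤ K) ⊓ Fil ℤ p))

end SC

/-! ### Homology of an endomorphism and the algebraic Künneth theorem -/

namespace DiffModule
open TensorProduct

variable {R : Type*} [CommRing R]
variable {M N P C D : Type*} [AddCommGroup M] [Module R M] [AddCommGroup N] [Module R N]
  [AddCommGroup P] [Module R P] [AddCommGroup C] [Module R C] [AddCommGroup D] [Module R D]

/-- The homology `ker d / (im d ∩ ker d)` of an endomorphism. -/
abbrev Homology (d : M →ₗ[R] M) : Type _ :=
  ↥(LinearMap.ker d) ⧸ (LinearMap.range d).submoduleOf (LinearMap.ker d)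

/-- The class of a cycle. -/
abbrev cls (d : M →ₗ[R] M) : LinearMap.ker d →ₗ[R] Homology d :=
  ((LinearMap.range d).submoduleOf (LinearMap.ker d)).mkQ

theorem cls_surjective (d : M →ₗ[R] M) : Function.Surjective (cls d) :=
  Submodule.mkQ_surjective _

theorem cls_eq_zero_iff {d : M →ₗ[R] M} {z : LinearMap.ker d} :
    cls d z = 0 ↔ ∃ y, d y = z := by
  rw [Submodule.mkQ_apply, Submodule.Quotient.mk_eq_zero]
  rfl

/-- `f` maps cycles to cycles and boundaries to boundaries. -/
structure Preserves (d : M →ₗ[R] M) (d' : N →ₗ[R] N) (f : M →ₗ[R] N) : Prop where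
  cycles : ∀ x ∈ LinearMap.ker d, f x ∈ LinearMap.ker d'
  boundaries : ∀ y, f (d y) ∈ LinearMap.range d'

theorem Preserves.of_comm {d : M →ₗ[R] M} {d' : N →ₗ[R] N} {f : M →ₗ[R] N}
    (h : f ∘ₗ d = d' ∘ₗ f) : Preserves d d' f where
  cycles x hx := by
    have := LinearMap.congr_fun h x
    rw [LinearMap.comp_apply, LinearMap.mem_ker.mp hx, map_zero] at this
    exact this.symm
  boundaries y := ⟨f y, (LinearMap.congr_fun h y).symm⟩

theorem Preserves.of_anticomm {d : M →ₗ[R] M} {d' : N →ₗ[R] N} {f : M →ₗ[R] N}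
    (h : f ∘ₗ d = -(d' ∘ₗ f)) : Preserves d d' f where
  cycles x hx := by
    have := LinearMap.congr_fun h x
    rw [LinearMap.comp_apply, LinearMap.mem_ker.mp hx, map_zero] at this
    exact neg_eq_zero.mp this.symm
  boundaries y := ⟨-f y, by rw [map_neg]; exact (LinearMap.congr_fun h y).symm⟩

/-- The map induced on cycles. -/
abbrev cyclesMap {d : M →ₗ[R] M} {d' : N →ₗ[R] N} (f : M →ₗ[R] N) (h : Preserves d d' f) :
    LinearMap.ker d →ₗ[R] LinearMap.ker d' :=
  f.restrict h.cycles

/-- The map induced on homology. -/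
def homologyMap {d : M →ₗ[R] M} {d' : N →ₗ[R] N} (f : M →ₗ[R] N) (h : Preserves d d' f) :
    Homology d →ₗ[R] Homology d' :=
  Submodule.mapQ _ _ (cyclesMap f h) <| by
    rintro ⟨_, hx⟩ ⟨y, rfl⟩
    exact h.boundaries y

@[simp] theorem homologyMap_cls {d : M →ₗ[R] M} {d' : N →ₗ[R] N} (f : M →ₗ[R] N)
    (h : Preserves d d' f) (z : LinearMap.ker d) :
    homologyMap f h (cls d z) = cls d' (cyclesMap f h z) := rfl

/-- The isomorphism induced on homology by an isomorphism of complexes. -/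
def homologyEquiv {d : M →ₗ[R] M} {d' : N →ₗ[R] N} (f : M ≃ₗ[R] N)
    (h : f.toLinearMap ∘ₗ d = d' ∘ₗ f.toLinearMap) : Homology d ≃ₗ[R] Homology d' :=
  have h' : f.symm.toLinearMap ∘ₗ d' = d ∘ₗ f.symm.toLinearMap := by
    ext x
    apply f.injective
    have := LinearMap.congr_fun h (f.symm x)
    simp only [LinearMap.comp_apply, LinearEquiv.coe_coe, LinearEquiv.apply_symm_apply] at this ⊢
    exact this.symm
  LinearEquiv.ofLinearMap (homologyMap f.toLinearMap (.of_comm h))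
    (homologyMap f.symm.toLinearMap (.of_comm h'))
    (by
      refine LinearMap.ext fun x => ?_
      obtain ⟨z, rfl⟩ := cls_surjective _ x
      simp only [LinearMap.comp_apply, homologyMap_cls, LinearMap.id_apply]
      congr 1
      ext
      simp)
    (by
      refine LinearMap.ext fun x => ?_
      obtain ⟨z, rfl⟩ := cls_surjective _ x
      simp only [LinearMap.comp_apply, homologyMap_cls, LinearMap.id_apply]
      congr 1
      ext
      simp)

/-- The differential `d ⊗ 1 + s ⊗ e` on a tensor product. -/
def tensorDiff (d s : C →ₗ[R] C) (e : D →ₗ[R] D) : C ⊗[R] D →ₗ[R] C ⊗[R] D :=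
  TensorProduct.map d LinearMap.id + TensorProduct.map s e

@[simp] theorem tensorDiff_tmul (d s : C →ₗ[R] C) (e : D →ₗ[R] D) (a : C) (b : D) :
    tensorDiff d s e (a ⊗ₜ b) = d a ⊗ₜ b + s a ⊗ₜ e b := rfl

section Kunneth

variable {d s : C →ₗ[R] C} {e : D →ₗ[R] D}

/-- The homology cross product on the level of cycles. -/
def crossCycles (d s : C →ₗ[R] C) (e : D →ₗ[R] D) :
    LinearMap.ker d ⊗[R] LinearMap.ker e →ₗ[R] LinearMap.ker (tensorDiff d s e) :=
  (TensorProduct.map (LinearMap.ker d).subtype (LinearMap.ker e).subtype).codRestrict _ fun x => by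
    induction x with
    | zero => simp
    | add x y hx hy => rw [map_add]; exact add_mem hx hy
    | tmul a b => simp

@[simp] theorem crossCycles_coe (x : LinearMap.ker d ⊗[R] LinearMap.ker e) :
    (crossCycles d s e x : C ⊗[R] D) =
      TensorProduct.map (LinearMap.ker d).subtype (LinearMap.ker e).subtype x := rfl

/-- The homology cross product. -/
def cross (hs : s ∘ₗ s = LinearMap.id) (hsd : s ∘ₗ d = -(d ∘ₗ s)) :
    Homology d ⊗[R] Homology e →ₗ[R] Homology (tensorDiff d s e) :=
  TensorProduct.lift <| LinearMap.liftQ₂ _ _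
    (LinearMap.compr₂ (TensorProduct.mk R (LinearMap.ker d) (LinearMap.ker e))
      (cls _ ∘ₗ crossCycles d s e))
    (by
      rintro ⟨x, hx⟩ ⟨y, hy⟩
      refine LinearMap.ext fun b => ?_
      change d y = x at hy
      refine cls_eq_zero_iff.mpr ⟨y ⊗ₜ b, ?_⟩
      simp [hy])
    (by
      rintro ⟨x, hx⟩ ⟨y, hy⟩
      refine LinearMap.ext fun a => ?_
      change e y = x at hy
      refine cls_eq_zero_iff.mpr ⟨s a ⊗ₜ y, ?_⟩
      have h1 := LinearMap.congr_fun hs a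
      have h2 := LinearMap.congr_fun hsd a
      simp only [LinearMap.comp_apply, LinearMap.id_apply, LinearMap.neg_apply,
        LinearMap.map_coe_ker, map_zero] at h1 h2
      simp [hy, h1, neg_eq_zero.mp h2.symm])

theorem cross_cls (hs : s ∘ₗ s = LinearMap.id) (hsd : s ∘ₗ d = -(d ∘ₗ s))
    (x : LinearMap.ker d ⊗[R] LinearMap.ker e) :
    cross hs hsd (TensorProduct.map (cls d) (cls e) x) = cls _ (crossCycles d s e x) := by
  induction x with
  | zero => simp
  | add x y hx hy => simp only [map_add, hx, hy]
  | tmul a b => rfl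

end Kunneth
end DiffModule

namespace DiffModule
open TensorProduct

variable {R : Type*} [CommRing R]
variable {C D : Type*} [AddCommGroup C] [Module R C] [AddCommGroup D] [Module R D]

section Kunneth

variable {d s : C →ₗ[R] C} {e : D →ₗ[R] D}

/-- The inclusion of boundaries into cycles. -/
abbrev boundaryIncl (d : C →ₗ[R] C) (hd : d ∘ₗ d = 0) : LinearMap.range d →ₗ[R] LinearMap.ker d :=
  Submodule.inclusion (LinearMap.range_le_ker_iff.mpr hd)

theorem exact_boundaryIncl_cls (hd : d ∘ₗ d = 0) :
    Function.Exact (boundaryIncl d hd) (cls d) := by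
  intro z
  rw [cls_eq_zero_iff]
  constructor
  · rintro ⟨y, hy⟩
    exact ⟨⟨z, y, hy⟩, rfl⟩
  · rintro ⟨⟨_, y, rfl⟩, rfl⟩
    exact ⟨y, rfl⟩

theorem exact_ker_subtype (f : C →ₗ[R] D) : Function.Exact (LinearMap.ker f).subtype f :=
  fun x => by simp

theorem exact_ker_subtype_rangeRestrict (d : C →ₗ[R] C) :
    Function.Exact (LinearMap.ker d).subtype d.rangeRestrict := by
  intro x
  simp [Subtype.ext_iff]

theorem injective_map_id_left {Q : Type*} [AddCommGroup Q] [Module R Q] [Module.Flat R Q]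
    (f : C →ₗ[R] D) (hf : Function.Injective f) :
    Function.Injective (TensorProduct.map (LinearMap.id : Q →ₗ[R] Q) f) :=
  Module.Flat.lTensor_preserves_injective_linearMap f hf

theorem injective_map_ker_subtype_id [Module.Flat R (LinearMap.range d)]
    (Q : Type*) [AddCommGroup Q] [Module R Q] :
    Function.Injective
      (TensorProduct.map (LinearMap.ker d).subtype (LinearMap.id : Q →ₗ[R] Q)) := by
  have := LinearMap.lTensor_injective_of_exact_of_flat d.rangeRestrict
    d.surjective_rangeRestrict (LinearMap.ker d).subtype (Submodule.subtype_injective _)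
    (exact_ker_subtype_rangeRestrict d) Q
  exact (LinearMap.lTensor_inj_iff_rTensor_inj _ _).mp this

theorem injective_map_ker_subtype [Module.Flat R (LinearMap.range d)]
    [Module.Flat R (LinearMap.ker d)] :
    Function.Injective
      (TensorProduct.map (LinearMap.ker d).subtype (LinearMap.ker e).subtype) := by
  have h : TensorProduct.map (LinearMap.ker d).subtype (LinearMap.ker e).subtype =
      TensorProduct.map (LinearMap.ker d).subtype LinearMap.id ∘ₗ
        TensorProduct.map LinearMap.id (LinearMap.ker e).subtype := by
    rw [← TensorProduct.map_comp, LinearMap.comp_id, LinearMap.id_comp]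
  rw [h, LinearMap.coe_comp]
  exact (injective_map_ker_subtype_id _).comp
    (injective_map_id_left _ (Submodule.subtype_injective _))

theorem exists_of_map_rangeRestrict_eq_zero {Q : Type*} [AddCommGroup Q] [Module R Q]
    (x : C ⊗[R] Q) (hx : TensorProduct.map d.rangeRestrict LinearMap.id x = 0) :
    ∃ t, TensorProduct.map (LinearMap.ker d).subtype LinearMap.id t = x :=
  (rTensor_exact Q (exact_ker_subtype_rangeRestrict d) d.surjective_rangeRestrict x).mp hx

theorem exists_of_map_id_eq_zero {Q : Type*} [AddCommGroup Q] [Module R Q] [Module.Flat R Q]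
    (x : Q ⊗[R] D) (hx : TensorProduct.map LinearMap.id e x = 0) :
    ∃ t, TensorProduct.map LinearMap.id (LinearMap.ker e).subtype t = x :=
  (Module.Flat.lTensor_exact Q (exact_ker_subtype e) x).mp hx

theorem exists_lifts_of_map_eq_zero [Module.Flat R (LinearMap.range d)] (he : e ∘ₗ e = 0)
    (u : C ⊗[R] D) (hu : TensorProduct.map d.rangeRestrict e u = 0) :
    (∃ y, TensorProduct.map LinearMap.id (LinearMap.ker e).subtype y =
        TensorProduct.map d.rangeRestrict LinearMap.id u) ∧
      ∃ w, TensorProduct.map (LinearMap.ker d).subtype (LinearMap.ker e).subtype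
        (TensorProduct.map LinearMap.id (boundaryIncl e he) w) =
          TensorProduct.map LinearMap.id e u := by
  constructor
  · apply exists_of_map_id_eq_zero
    rwa [TensorProduct.map_map]
  · obtain ⟨w, hw⟩ := exists_of_map_rangeRestrict_eq_zero (d := d)
      (TensorProduct.map LinearMap.id e.rangeRestrict u) <| by
        apply injective_map_id_left (LinearMap.range e).subtype (Submodule.subtype_injective _)
        rw [TensorProduct.map_map, TensorProduct.map_map, map_zero]
        exact hu
    refine ⟨w, ?_⟩
    have := congrArg (TensorProduct.map LinearMap.id (LinearMap.range e).subtype) hw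
    rw [TensorProduct.map_map, TensorProduct.map_map] at this
    rw [TensorProduct.map_map]
    exact this

/-- The restriction of `s` to the cycles of an anticommuting differential. -/
abbrev cyclesSign (hsd : s ∘ₗ d = -(d ∘ₗ s)) : LinearMap.ker d →ₗ[R] LinearMap.ker d :=
  cyclesMap s (.of_anticomm hsd)

theorem subtype_comp_cyclesSign (hsd : s ∘ₗ d = -(d ∘ₗ s)) :
    (LinearMap.ker d).subtype ∘ₗ cyclesSign hsd = s ∘ₗ (LinearMap.ker d).subtype := rfl

theorem cyclesSign_comp_cyclesSign (hs : s ∘ₗ s = LinearMap.id) (hsd : s ∘ₗ d = -(d ∘ₗ s)) :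
    cyclesSign hsd ∘ₗ cyclesSign hsd = LinearMap.id :=
  LinearMap.ext fun z => Subtype.ext (LinearMap.congr_fun hs z)

theorem cls_comp_cyclesSign_comp_boundaryIncl (hd : d ∘ₗ d = 0) (hsd : s ∘ₗ d = -(d ∘ₗ s)) :
    cls d ∘ₗ cyclesSign hsd ∘ₗ boundaryIncl d hd = 0 := by
  refine LinearMap.ext ?_
  rintro ⟨_, y, rfl⟩
  refine cls_eq_zero_iff.mpr ⟨-s y, ?_⟩
  rw [map_neg]
  exact (LinearMap.congr_fun hsd y).symm

theorem cls_comp_boundaryIncl (hd : d ∘ₗ d = 0) : cls d ∘ₗ boundaryIncl d hd = 0 :=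
  LinearMap.ext fun y => (exact_boundaryIncl_cls hd _).mpr ⟨y, rfl⟩

theorem map_diff_eq_map_subtype (hd : d ∘ₗ d = 0) (hsd : s ∘ₗ d = -(d ∘ₗ s))
    {u : C ⊗[R] D} {y : LinearMap.range d ⊗[R] LinearMap.ker e}
    (hy : TensorProduct.map LinearMap.id (LinearMap.ker e).subtype y =
        TensorProduct.map d.rangeRestrict LinearMap.id u) :
    TensorProduct.map (s ∘ₗ d) LinearMap.id u =
      TensorProduct.map (LinearMap.ker d).subtype (LinearMap.ker e).subtype
        (TensorProduct.map (cyclesSign hsd ∘ₗ boundaryIncl d hd) LinearMap.id y) := by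
  have := congrArg (TensorProduct.map
    (s ∘ₗ (LinearMap.ker d).subtype ∘ₗ boundaryIncl d hd) LinearMap.id) hy
  rw [TensorProduct.map_map, TensorProduct.map_map] at this
  rw [TensorProduct.map_map]
  exact this.symm

theorem tensorDiff_comp_tensorDiff (hd : d ∘ₗ d = 0) (hsd : s ∘ₗ d = -(d ∘ₗ s))
    (he : e ∘ₗ e = 0) : tensorDiff d s e ∘ₗ tensorDiff d s e = 0 := by
  refine TensorProduct.ext' fun a b => ?_
  have h1 := LinearMap.congr_fun hd a
  have h2 := LinearMap.congr_fun hsd a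
  have h3 := LinearMap.congr_fun he b
  simp only [LinearMap.comp_apply, LinearMap.neg_apply, LinearMap.zero_apply] at h1 h2 h3
  simp [h1, h2, h3, TensorProduct.neg_tmul]

theorem tensorDiff_map_sign (hs : s ∘ₗ s = LinearMap.id) (hsd : s ∘ₗ d = -(d ∘ₗ s))
    (u : C ⊗[R] D) :
    tensorDiff d s e (TensorProduct.map s LinearMap.id u) =
      -TensorProduct.map (s ∘ₗ d) LinearMap.id u + TensorProduct.map LinearMap.id e u := by
  induction u with
  | zero => simp
  | add x y hx hy => simp only [map_add, hx, hy]; abel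
  | tmul a b =>
    have h1 := LinearMap.congr_fun hs a
    have h2 := LinearMap.congr_fun hsd a
    simp only [LinearMap.comp_apply, LinearMap.neg_apply, LinearMap.id_apply] at h1 h2
    simp [h1, h2, TensorProduct.neg_tmul]

theorem map_sign_map_sign (hs : s ∘ₗ s = LinearMap.id) (u : C ⊗[R] D) :
    TensorProduct.map s LinearMap.id (TensorProduct.map s LinearMap.id u) = u := by
  rw [TensorProduct.map_map, hs, LinearMap.id_comp, TensorProduct.map_id, LinearMap.id_apply]

theorem cross_injective [Module.Flat R (LinearMap.range d)] [Module.Flat R (LinearMap.ker d)]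
    (hd : d ∘ₗ d = 0) (hs : s ∘ₗ s = LinearMap.id) (hsd : s ∘ₗ d = -(d ∘ₗ s))
    (he : e ∘ₗ e = 0) : Function.Injective (cross (e := e) hs hsd) := by
  rw [injective_iff_map_eq_zero]
  intro x hx
  obtain ⟨ξ, rfl⟩ := TensorProduct.map_surjective (cls_surjective d) (cls_surjective e) x
  rw [cross_cls, cls_eq_zero_iff, crossCycles_coe] at hx
  obtain ⟨v, hv⟩ := hx
  obtain ⟨u, rfl⟩ : ∃ u, TensorProduct.map s LinearMap.id u = v := ⟨_, map_sign_map_sign hs v⟩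
  rw [tensorDiff_map_sign hs hsd] at hv
  obtain ⟨⟨y, hy⟩, w, hw⟩ := exists_lifts_of_map_eq_zero (d := d) he u <| by
    have h := congrArg (TensorProduct.map d.rangeRestrict LinearMap.id) hv
    have h1 : d.rangeRestrict ∘ₗ s ∘ₗ d = 0 := by
      rw [hsd]
      ext z
      simpa using congrArg (-·) (LinearMap.congr_fun hd (s z))
    have h2 : d.rangeRestrict ∘ₗ (LinearMap.ker d).subtype = 0 := by
      ext z
      simp
    rw [map_add, map_neg, TensorProduct.map_map, TensorProduct.map_map, TensorProduct.map_map, h1,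
      h2] at h
    simpa using h
  rw [map_diff_eq_map_subtype hd hsd hy, ← hw, ← map_neg, ← map_add] at hv
  rw [← injective_map_ker_subtype hv, map_add, map_neg, TensorProduct.map_map,
    TensorProduct.map_map, cls_comp_cyclesSign_comp_boundaryIncl, cls_comp_boundaryIncl]
  simp

theorem cross_surjective [Module.Flat R (LinearMap.range d)] [Module.Flat R (LinearMap.ker d)]
    (hd : d ∘ₗ d = 0) (hs : s ∘ₗ s = LinearMap.id) (hsd : s ∘ₗ d = -(d ∘ₗ s))
    (he : e ∘ₗ e = 0)
    (hinj : Function.Injective (TensorProduct.map (boundaryIncl d hd)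
      (LinearMap.id : Homology e →ₗ[R] Homology e))) :
    Function.Surjective (cross (e := e) hs hsd) := by
  intro x
  obtain ⟨⟨z, hz⟩, rfl⟩ := cls_surjective _ x
  have hds : d.rangeRestrict ∘ₗ s ∘ₗ d = 0 := by
    rw [hsd]
    ext z
    simpa using congrArg (-·) (LinearMap.congr_fun hd (s z))
  obtain ⟨u, rfl⟩ : ∃ u, TensorProduct.map s LinearMap.id u = z := ⟨_, map_sign_map_sign hs z⟩
  have hz' := LinearMap.mem_ker.mp hz
  rw [tensorDiff_map_sign hs hsd, neg_add_eq_zero] at hz'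
  obtain ⟨⟨y, hy⟩, w, hw⟩ := exists_lifts_of_map_eq_zero (d := d) he u <| by
    have h := congrArg (TensorProduct.map d.rangeRestrict LinearMap.id) hz'
    rw [TensorProduct.map_map, TensorProduct.map_map, hds] at h
    simpa using h.symm
  rw [map_diff_eq_map_subtype hd hsd hy, ← hw] at hz'
  have hz'' := injective_map_ker_subtype hz'
  have hy0 : TensorProduct.map LinearMap.id (cls e) y = 0 := by
    apply hinj
    have h := congrArg (TensorProduct.map (cyclesSign hsd) (cls e)) hz''
    rw [TensorProduct.map_map, TensorProduct.map_map, cls_comp_boundaryIncl,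
      ← LinearMap.comp_assoc, cyclesSign_comp_cyclesSign hs hsd] at h
    rw [TensorProduct.map_map]
    simpa using h
  obtain ⟨y', hy'⟩ := (lTensor_exact (LinearMap.range d) (exact_boundaryIncl_cls he)
    (cls_surjective e) y).mp hy0
  obtain ⟨v, rfl⟩ := TensorProduct.map_surjective d.surjective_rangeRestrict
    e.surjective_rangeRestrict y'
  have hv : TensorProduct.map d.rangeRestrict e v =
      TensorProduct.map d.rangeRestrict LinearMap.id u := by
    rw [← hy, ← hy', LinearMap.lTensor, TensorProduct.map_map, TensorProduct.map_map]
    rfl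
  obtain ⟨t, ht⟩ := exists_of_map_rangeRestrict_eq_zero (d := d)
    (u - TensorProduct.map LinearMap.id e v - TensorProduct.map (s ∘ₗ d) LinearMap.id v) <| by
      rw [map_sub, map_sub, TensorProduct.map_map, TensorProduct.map_map, hds, LinearMap.id_comp,
        LinearMap.comp_id, hv]
      simp
  have htot : TensorProduct.map s LinearMap.id u - tensorDiff d s e v =
      TensorProduct.map (LinearMap.ker d).subtype LinearMap.id
        (TensorProduct.map (cyclesSign hsd) LinearMap.id t) := by
    rw [TensorProduct.map_map, subtype_comp_cyclesSign, ← TensorProduct.map_map s _ _ _ t, ht,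
      map_sub, map_sub]
    rw [TensorProduct.map_map, TensorProduct.map_map, ← LinearMap.comp_assoc, hs, tensorDiff,
      LinearMap.add_apply]
    simp only [LinearMap.id_comp, LinearMap.comp_id]
    abel
  generalize TensorProduct.map (cyclesSign hsd) LinearMap.id t = t' at htot
  have ht' : TensorProduct.map LinearMap.id e t' = 0 := by
    have h := congrArg (tensorDiff d s e) htot
    have h0 : d ∘ₗ (LinearMap.ker d).subtype = 0 := LinearMap.ext fun z => z.2
    rw [map_sub, LinearMap.mem_ker.mp hz, ← LinearMap.comp_apply (tensorDiff d s e),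
      tensorDiff_comp_tensorDiff hd hsd he, tensorDiff, LinearMap.add_apply,
      TensorProduct.map_map, TensorProduct.map_map, h0, ← subtype_comp_cyclesSign hsd] at h
    have h' : TensorProduct.map (LinearMap.ker d).subtype LinearMap.id
        (TensorProduct.map (cyclesSign hsd) e t') = 0 := by
      rw [TensorProduct.map_map]
      simpa using h.symm
    have h'' := congrArg (TensorProduct.map (cyclesSign hsd) LinearMap.id)
      (injective_map_ker_subtype_id D (h'.trans (map_zero _).symm))
    rw [TensorProduct.map_map, cyclesSign_comp_cyclesSign hs hsd, map_zero] at h''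
    exact h''
  obtain ⟨ξ, hξ⟩ := exists_of_map_id_eq_zero t' ht'
  refine ⟨TensorProduct.map (cls d) (cls e) ξ, ?_⟩
  rw [cross_cls, ← sub_eq_zero, ← map_sub, cls_eq_zero_iff]
  refine ⟨-v, ?_⟩
  have h := htot
  rw [← hξ, TensorProduct.map_map, LinearMap.comp_id, LinearMap.id_comp] at h
  rw [map_neg, Submodule.coe_sub, crossCycles_coe, ← h]
  simp

theorem cross_bijective [Module.Flat R (LinearMap.range d)] [Module.Flat R (LinearMap.ker d)]
    (hd : d ∘ₗ d = 0) (hs : s ∘ₗ s = LinearMap.id) (hsd : s ∘ₗ d = -(d ∘ₗ s))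
    (he : e ∘ₗ e = 0) (h : Module.Flat R (Homology d) ∨ Module.Flat R (Homology e)) :
    Function.Bijective (cross (e := e) hs hsd) := by
  refine ⟨cross_injective hd hs hsd he, cross_surjective hd hs hsd he ?_⟩
  have hi : Function.Injective (boundaryIncl d hd) := Submodule.inclusion_injective _
  rcases h with h | h
  · exact (LinearMap.lTensor_inj_iff_rTensor_inj _ _).mp <|
      LinearMap.lTensor_injective_of_exact_of_flat (cls d) (cls_surjective d) _ hi
        (exact_boundaryIncl_cls hd) _
  · exact Module.Flat.rTensor_preserves_injective_linearMap _ hi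

end Kunneth
end DiffModule

/-! ### The second page of a double complex -/

namespace DiffModule
open TensorProduct

variable {R : Type*} [CommRing R]
variable {M C D : Type*} [AddCommGroup M] [Module R M]
  [AddCommGroup C] [Module R C] [AddCommGroup D] [Module R D]

/-- Vertical cycles whose horizontal differential is a vertical boundary. -/
def secondCycles (dv dh : M →ₗ[R] M) : Submodule R M :=
  LinearMap.ker dv ⊓ (LinearMap.range dv).comap dh

/-- Sums of vertical boundaries and horizontal boundaries of vertical cycles. -/
def secondBoundaries (dv dh : M →ₗ[R] M) : Submodule R M :=
  LinearMap.range dv ⊔ (LinearMap.ker dv).map dh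

/-- The second page of the spectral sequence of a double complex, without gradings. -/
abbrev SecondPage (dv dh : M →ₗ[R] M) : Type _ :=
  ↥(secondCycles dv dh) ⧸ (secondBoundaries dv dh).submoduleOf (secondCycles dv dh)

/-- The class of a cycle on the second page. -/
abbrev cls₂ (dv dh : M →ₗ[R] M) : secondCycles dv dh →ₗ[R] SecondPage dv dh :=
  ((secondBoundaries dv dh).submoduleOf (secondCycles dv dh)).mkQ

theorem cls₂_surjective (dv dh : M →ₗ[R] M) : Function.Surjective (cls₂ dv dh) :=
  Submodule.mkQ_surjective _

variable {dv dh : M →ₗ[R] M}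

/-- The iterated class of a cycle of the second page. -/
def iteratedCls (h : Preserves dv dv dh) : secondCycles dv dh →ₗ[R] Homology (homologyMap dh h) :=
  cls (homologyMap dh h) ∘ₗ
    (cls dv ∘ₗ
      Submodule.inclusion (inf_le_left : secondCycles dv dh ≤ LinearMap.ker dv)).codRestrict
      _ fun z => cls_eq_zero_iff.mpr z.2.2

theorem iteratedCls_surjective (h : Preserves dv dv dh) :
    Function.Surjective (iteratedCls h) := by
  intro x
  obtain ⟨⟨y, hy⟩, rfl⟩ := cls_surjective _ x
  obtain ⟨z, rfl⟩ := cls_surjective _ y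
  exact ⟨⟨z, z.2, cls_eq_zero_iff.mp hy⟩, rfl⟩

theorem ker_iteratedCls (h : Preserves dv dv dh) :
    LinearMap.ker (iteratedCls h) =
      (secondBoundaries dv dh).submoduleOf (secondCycles dv dh) := by
  ext ⟨z, hz⟩
  change cls _ _ = 0 ↔ z ∈ secondBoundaries dv dh
  rw [cls_eq_zero_iff, secondBoundaries, Submodule.mem_sup]
  constructor
  · rintro ⟨y, hy⟩
    obtain ⟨⟨w, hw⟩, rfl⟩ := cls_surjective _ y
    change cls dv _ = cls dv _ at hy
    rw [← sub_eq_zero, ← map_sub, cls_eq_zero_iff] at hy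
    obtain ⟨v, hv⟩ := hy
    refine ⟨dv (-v), ⟨_, rfl⟩, dh w, ⟨w, hw, rfl⟩, ?_⟩
    rw [map_neg, hv]
    change -(dh w - z) + dh w = z
    abel
  · rintro ⟨_, ⟨v, rfl⟩, _, ⟨w, hw, rfl⟩, hz'⟩
    refine ⟨cls dv ⟨w, hw⟩, ?_⟩
    change cls dv _ = cls dv _
    rw [← sub_eq_zero, ← map_sub, cls_eq_zero_iff]
    refine ⟨-v, ?_⟩
    change dv (-v) = dh w - z
    rw [map_neg, ← hz']
    abel

/-- The second page is the iterated homology. -/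
noncomputable def secondPageEquiv (h : Preserves dv dv dh) :
    SecondPage dv dh ≃ₗ[R] Homology (homologyMap dh h) :=
  Submodule.quotEquivOfEq _ _ (ker_iteratedCls h).symm ≪≫ₗ
    (iteratedCls h).quotKerEquivOfSurjective (iteratedCls_surjective h)

theorem flat_iteratedHomology [IsDedekindDomain R] (h : Preserves dv dv dh)
    (ht : Module.IsTorsionFree R (SecondPage dv dh)) :
    Module.Flat R (Homology (homologyMap dh h)) :=
  have := (secondPageEquiv h).symm.injective.moduleIsTorsionFree _
    fun r x => map_smul (secondPageEquiv h).symm r x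
  inferInstance

section Kunneth

variable {dv dh s : C →ₗ[R] C} {ev eh : D →ₗ[R] D}

theorem tensorDiff_anticomm (hs : s ∘ₗ s = LinearMap.id) (hsv : s ∘ₗ dv = -(dv ∘ₗ s))
    (hsh : s ∘ₗ dh = -(dh ∘ₗ s)) (hd : dh ∘ₗ dv = -(dv ∘ₗ dh)) (he : eh ∘ₗ ev = -(ev ∘ₗ eh)) :
    tensorDiff dh s eh ∘ₗ tensorDiff dv s ev = -(tensorDiff dv s ev ∘ₗ tensorDiff dh s eh) := by
  refine TensorProduct.ext' fun a b => ?_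
  have h1 := LinearMap.congr_fun hs a
  have h2 := LinearMap.congr_fun hsv a
  have h3 := LinearMap.congr_fun hsh a
  have h4 := LinearMap.congr_fun hd a
  have h5 := LinearMap.congr_fun he b
  simp only [LinearMap.comp_apply, LinearMap.neg_apply, LinearMap.id_apply] at h1 h2 h3 h4 h5
  simp only [LinearMap.comp_apply, LinearMap.neg_apply, tensorDiff_tmul, map_add, h1, h2, h3, h4,
    h5, TensorProduct.neg_tmul, TensorProduct.tmul_neg]
  abel

theorem tmul_mem_secondCycles (hs : s ∘ₗ s = LinearMap.id) (hsv : s ∘ₗ dv = -(dv ∘ₗ s))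
    (a : secondCycles dv dh) (b : secondCycles ev eh) :
    (a : C) ⊗ₜ[R] (b : D) ∈ secondCycles (tensorDiff dv s ev) (tensorDiff dh s eh) := by
  obtain ⟨a, ha, x, hx⟩ := a
  obtain ⟨b, hb, y, hy⟩ := b
  have ha' : dv a = 0 := ha
  have hb' : ev b = 0 := hb
  have h1 := LinearMap.congr_fun hs a
  have h2 := LinearMap.congr_fun hsv (s a)
  have h3 := LinearMap.congr_fun hsv a
  simp only [LinearMap.comp_apply, LinearMap.neg_apply, LinearMap.id_apply, ha', map_zero]
    at h1 h2 h3
  refine ⟨by simp [ha', hb'], x ⊗ₜ b + a ⊗ₜ y, ?_⟩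
  simp [hx, hy, ha', hb']

/-- The algebraic Künneth theorem for the second page of a tensor product of double complexes. -/
theorem exists_secondPage_kunneth [IsDedekindDomain R] [Module.IsTorsionFree R C]
    (hs : s ∘ₗ s = LinearMap.id) (hsv : s ∘ₗ dv = -(dv ∘ₗ s)) (hsh : s ∘ₗ dh = -(dh ∘ₗ s))
    (hdv : dv ∘ₗ dv = 0) (hdh : dh ∘ₗ dh = 0) (hd : dh ∘ₗ dv = -(dv ∘ₗ dh))
    (hev : ev ∘ₗ ev = 0) (heh : eh ∘ₗ eh = 0) (he : eh ∘ₗ ev = -(ev ∘ₗ eh))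
    [Module.IsTorsionFree R (Homology dv)]
    (h₂ : Module.IsTorsionFree R (SecondPage dv dh) ∨ Module.IsTorsionFree R (SecondPage ev eh)) :
    ∃ Φ : SecondPage dv dh ⊗[R] SecondPage ev eh ≃ₗ[R]
        SecondPage (tensorDiff dv s ev) (tensorDiff dh s eh),
      ∀ a b, Φ (cls₂ dv dh a ⊗ₜ cls₂ ev eh b) =
        cls₂ _ _ ⟨(a : C) ⊗ₜ[R] (b : D), tmul_mem_secondCycles hs hsv a b⟩ := by
  have pd : Preserves dv dv dh := .of_anticomm hd
  have pe : Preserves ev ev eh := .of_anticomm he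
  have ps : Preserves dv dv s := .of_anticomm hsv
  have pt : Preserves (tensorDiff dv s ev) (tensorDiff dv s ev) (tensorDiff dh s eh) :=
    .of_anticomm (tensorDiff_anticomm hs hsv hsh hd he)
  have hs' : homologyMap s ps ∘ₗ homologyMap s ps = LinearMap.id := by
    refine LinearMap.ext fun x => ?_
    obtain ⟨z, rfl⟩ := cls_surjective _ x
    exact congrArg (cls dv) (Subtype.ext (LinearMap.congr_fun hs z))
  have hsh' : homologyMap s ps ∘ₗ homologyMap dh pd =
      -(homologyMap dh pd ∘ₗ homologyMap s ps) := by
    refine LinearMap.ext fun x => ?_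
    obtain ⟨z, rfl⟩ := cls_surjective _ x
    exact congrArg (cls dv) (Subtype.ext (LinearMap.congr_fun hsh z))
  have hdh' : homologyMap dh pd ∘ₗ homologyMap dh pd = 0 := by
    refine LinearMap.ext fun x => ?_
    obtain ⟨z, rfl⟩ := cls_surjective _ x
    exact congrArg (cls dv) (Subtype.ext (LinearMap.congr_fun hdh z))
  have heh' : homologyMap eh pe ∘ₗ homologyMap eh pe = 0 := by
    refine LinearMap.ext fun x => ?_
    obtain ⟨z, rfl⟩ := cls_surjective _ x
    exact congrArg (cls ev) (Subtype.ext (LinearMap.congr_fun heh z))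
  let Ψ₁ := LinearEquiv.ofBijective _
    (cross_bijective (e := ev) hdv hs hsv hev (.inl inferInstance))
  have hΨ₁ : Ψ₁.toLinearMap ∘ₗ tensorDiff (homologyMap dh pd) (homologyMap s ps)
      (homologyMap eh pe) = homologyMap (tensorDiff dh s eh) pt ∘ₗ Ψ₁.toLinearMap := by
    refine TensorProduct.ext' fun x y => ?_
    obtain ⟨z, rfl⟩ := cls_surjective _ x
    obtain ⟨w, rfl⟩ := cls_surjective _ y
    rfl
  let Ψ₂ := LinearEquiv.ofBijective _ (cross_bijective (e := homologyMap eh pe) hdh' hs' hsh' heh'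
    (h₂.imp (flat_iteratedHomology pd) (flat_iteratedHomology pe)))
  refine ⟨TensorProduct.congr (secondPageEquiv pd) (secondPageEquiv pe) ≪≫ₗ Ψ₂ ≪≫ₗ
    homologyEquiv Ψ₁ hΨ₁ ≪≫ₗ (secondPageEquiv pt).symm, fun a b => ?_⟩
  rw [LinearEquiv.trans_apply, LinearEquiv.trans_apply, LinearEquiv.trans_apply,
    LinearEquiv.symm_apply_eq]
  rfl

end Kunneth
end DiffModule

/-! ### Transport of second pages and regrading of tensor products -/

namespace DiffModule
open TensorProduct DirectSum

section Transport

variable {R : Type*} [CommRing R]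
variable {M N : Type*} [AddCommGroup M] [Module R M] [AddCommGroup N] [Module R N]
variable {dv dh : M →ₗ[R] M} {ev eh : N →ₗ[R] N}

theorem mem_secondCycles_of_comm {f : M →ₗ[R] N} (hv : f ∘ₗ dv = ev ∘ₗ f)
    (hh : f ∘ₗ dh = eh ∘ₗ f) {z : M} (hz : z ∈ secondCycles dv dh) :
    f z ∈ secondCycles ev eh := by
  obtain ⟨hz, y, hy⟩ := hz
  refine ⟨?_, f y, ?_⟩
  · exact (Preserves.of_comm hv).cycles z hz
  · rw [← LinearMap.comp_apply, ← hv, LinearMap.comp_apply, hy, ← LinearMap.comp_apply, hh]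
    rfl

/-- The map of second pages induced by a map of double complexes. -/
def secondPageMap (f : M →ₗ[R] N) (hv : f ∘ₗ dv = ev ∘ₗ f) (hh : f ∘ₗ dh = eh ∘ₗ f) :
    SecondPage dv dh →ₗ[R] SecondPage ev eh :=
  Submodule.mapQ _ _ (f.restrict fun _ => mem_secondCycles_of_comm hv hh) <| by
    rintro ⟨z, _⟩ hz
    change z ∈ secondBoundaries dv dh at hz
    change f z ∈ secondBoundaries ev eh
    obtain ⟨_, ⟨y, rfl⟩, _, ⟨w, hw, rfl⟩, rfl⟩ := Submodule.mem_sup.mp hz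
    refine Submodule.mem_sup.mpr ⟨_, ⟨f y, rfl⟩, _, ⟨f w, ?_, rfl⟩, ?_⟩
    · exact (Preserves.of_comm hv).cycles w hw
    · rw [map_add, ← LinearMap.comp_apply, ← hv, ← LinearMap.comp_apply, ← hh]
      rfl

theorem comm_symm {f : M ≃ₗ[R] N} {d : M →ₗ[R] M} {e : N →ₗ[R] N}
    (h : f.toLinearMap ∘ₗ d = e ∘ₗ f.toLinearMap) :
    f.symm.toLinearMap ∘ₗ e = d ∘ₗ f.symm.toLinearMap := by
  ext x
  apply f.injective
  have := LinearMap.congr_fun h (f.symm x)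
  simp only [LinearMap.comp_apply, LinearEquiv.coe_coe, LinearEquiv.apply_symm_apply] at this ⊢
  exact this.symm

/-- The isomorphism of second pages induced by an isomorphism of double complexes. -/
def secondPageCongr (f : M ≃ₗ[R] N) (hv : f.toLinearMap ∘ₗ dv = ev ∘ₗ f.toLinearMap)
    (hh : f.toLinearMap ∘ₗ dh = eh ∘ₗ f.toLinearMap) :
    SecondPage dv dh ≃ₗ[R] SecondPage ev eh :=
  LinearEquiv.ofLinearMap (secondPageMap f.toLinearMap hv hh)
    (secondPageMap f.symm.toLinearMap (comm_symm hv) (comm_symm hh))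
    (by
      refine LinearMap.ext fun x => ?_
      obtain ⟨z, rfl⟩ := cls₂_surjective _ _ x
      exact congrArg (cls₂ ev eh) (Subtype.ext (f.apply_symm_apply z)))
    (by
      refine LinearMap.ext fun x => ?_
      obtain ⟨z, rfl⟩ := cls₂_surjective _ _ x
      exact congrArg (cls₂ dv dh) (Subtype.ext (f.symm_apply_apply z)))

end Transport

section Regrading

variable {R : Type*} [CommRing R] {I J : Type*}
variable {A : I → Type*} {B : J → Type*} {MA MB T T₀ : Type*}
  [∀ i, AddCommGroup (A i)] [∀ i, Module R (A i)] [∀ j, AddCommGroup (B j)] [∀ j, Module R (B j)]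
  [AddCommGroup MA] [Module R MA] [AddCommGroup MB] [Module R MB]
  [AddCommGroup T] [Module R T] [AddCommGroup T₀] [Module R T₀]

/-- A finite decomposition of `M` as an internal direct sum of the `A i`, given by inclusions
and projections. -/
structure Splitting (A : I → Type*) (M : Type*) [∀ i, AddCommGroup (A i)] [∀ i, Module R (A i)]
    [AddCommGroup M] [Module R M] (inc : ∀ i, A i →ₗ[R] M) (pr : ∀ i, M →ₗ[R] A i) : Prop where
  pr_inc_self : ∀ i a, pr i (inc i a) = a
  pr_inc_of_ne : ∀ i i', i ≠ i' → ∀ a, pr i' (inc i a) = 0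
  exists_sum : ∃ S : Finset I, ∀ x, ∑ i ∈ S, inc i (pr i x) = x

theorem Splitting.isTorsionFree [IsDomain R] {incA : ∀ i, A i →ₗ[R] MA} {prA : ∀ i, MA →ₗ[R] A i}
    (hA : Splitting A MA incA prA) (h : ∀ i, Module.IsTorsionFree R (A i)) :
    Module.IsTorsionFree R MA := by
  refine Module.isTorsionFree_iff_smul_eq_zero.mpr fun r x hx => ?_
  by_cases hr : r = 0
  · exact .inl hr
  obtain ⟨S, hS⟩ := hA.exists_sum
  refine .inr ?_
  rw [← hS x]
  refine Finset.sum_eq_zero fun i _ => ?_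
  have : r • prA i x = 0 := by rw [← map_smul, hx, map_zero]
  rw [(Module.isTorsionFree_iff_smul_eq_zero.mp (h i) _ _ this).resolve_left hr, map_zero]

theorem nonempty_directSum_equiv {incA : ∀ i, A i →ₗ[R] MA} {prA : ∀ i, MA →ₗ[R] A i}
    (hA : Splitting A MA incA prA) {incB : ∀ j, B j →ₗ[R] MB} {prB : ∀ j, MB →ₗ[R] B j}
    (hB : Splitting B MB incB prB) {incT : T₀ →ₗ[R] T} {prT : T →ₗ[R] T₀}
    (hT : ∀ t, prT (incT t) = t) (Φ : MA ⊗[R] MB ≃ₗ[R] T) (P : I × J → Prop)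
    (hP : ∀ i j, P (i, j) → ∀ a b,
      incT (prT (Φ (incA i a ⊗ₜ incB j b))) = Φ (incA i a ⊗ₜ incB j b))
    (hN : ∀ i j, ¬ P (i, j) → ∀ a b, prT (Φ (incA i a ⊗ₜ incB j b)) = 0) :
    Nonempty ((⨁ x : {x // P x}, A x.val.1 ⊗[R] B x.val.2) ≃ₗ[R] T₀) := by
  let F (x : {x // P x}) : A x.val.1 ⊗[R] B x.val.2 →ₗ[R] T₀ :=
    prT ∘ₗ Φ.toLinearMap ∘ₗ TensorProduct.map (incA x.val.1) (incB x.val.2)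
  let r (x : {x // P x}) : T₀ →ₗ[R] A x.val.1 ⊗[R] B x.val.2 :=
    TensorProduct.map (prA x.val.1) (prB x.val.2) ∘ₗ Φ.symm.toLinearMap ∘ₗ incT
  classical
  let f := DirectSum.toModule R {x // P x} T₀ F
  have hr (x) : r x ∘ₗ f =
      DirectSum.component R _ (fun x : {x // P x} => A x.val.1 ⊗[R] B x.val.2) x := by
    refine DirectSum.linearMap_ext R fun y => TensorProduct.ext' fun a b => ?_
    have h1 : f (DirectSum.lof R _ (fun x : {x // P x} => A x.val.1 ⊗[R] B x.val.2) y (a ⊗ₜ b)) =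
        F y (a ⊗ₜ b) := DirectSum.toModule_lof ..
    have h2 : r x (F y (a ⊗ₜ b)) =
        prA x.val.1 (incA y.val.1 a) ⊗ₜ prB x.val.2 (incB y.val.2 b) := by
      change TensorProduct.map _ _ (Φ.symm (incT (prT (Φ (incA _ a ⊗ₜ incB _ b))))) = _
      rw [hP _ _ y.2, LinearEquiv.symm_apply_apply, TensorProduct.map_tmul]
    simp only [LinearMap.comp_apply]
    rw [h1, h2]
    by_cases hxy : y = x
    · subst hxy
      rw [hA.pr_inc_self, hB.pr_inc_self]
      exact (DirectSum.component.lof_self R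
        (M := fun x : {x // P x} => A x.val.1 ⊗[R] B x.val.2) y _).symm
    · rw [DirectSum.component.of, dif_neg hxy]
      by_cases hi : y.val.1 = x.val.1
      · have hj : y.val.2 ≠ x.val.2 := fun hj => hxy (Subtype.ext (Prod.ext hi hj))
        rw [hB.pr_inc_of_ne _ _ hj, TensorProduct.tmul_zero]
      · rw [hA.pr_inc_of_ne _ _ hi, TensorProduct.zero_tmul]
  refine ⟨LinearEquiv.ofBijective f ⟨?_, fun t => ?_⟩⟩
  · refine (injective_iff_map_eq_zero f).mpr fun u hu => DFinsupp.ext fun x => ?_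
    have := LinearMap.congr_fun (hr x) u
    rw [LinearMap.comp_apply, hu, map_zero] at this
    exact this.symm
  · obtain ⟨S, hS⟩ := hA.exists_sum
    obtain ⟨S', hS'⟩ := hB.exists_sum
    have key (m : MA ⊗[R] MB) : prT (Φ m) ∈ LinearMap.range f := by
      induction m with
      | zero => simp
      | add m m' h h' => rw [map_add, map_add]; exact add_mem h h'
      | tmul a b =>
        rw [← hS a, ← hS' b, TensorProduct.sum_tmul, map_sum, map_sum]
        refine Submodule.sum_mem _ fun i _ => ?_
        rw [TensorProduct.tmul_sum, map_sum, map_sum]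
        refine Submodule.sum_mem _ fun j _ => ?_
        by_cases h : P (i, j)
        · exact ⟨DirectSum.lof R _ (fun x : {x // P x} => A x.val.1 ⊗[R] B x.val.2) ⟨(i, j), h⟩
            (prA i a ⊗ₜ prB j b), DirectSum.toModule_lof ..⟩
        · rw [hN i j h]
          exact zero_mem _
    have := key (Φ.symm (incT t))
    rwa [LinearEquiv.apply_symm_apply, hT] at this

end Regrading
end DiffModule

/-! ### The double complex on pairs of simplices -/

namespace SC

section Signs

theorem psgn_mul_self (v : ℕ) (s : Finset ℕ) : psgn v s * psgn v s = 1 := by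
  rw [psgn, ← mul_pow]
  simp

theorem psgn_insert_self (v : ℕ) (s : Finset ℕ) : psgn v (insert v s) = psgn v s := by
  simp [psgn, filter_insert]

theorem psgn_insert {v w : ℕ} {s : Finset ℕ} (hw : w ∉ s) :
    psgn v (insert w s) = (if w < v then -1 else 1) * psgn v s := by
  unfold psgn
  rw [filter_insert]
  split_ifs with h
  · rw [card_insert_of_notMem (by simp [hw]), pow_succ']
  · rw [one_mul]

theorem psgn_union (v : ℕ) {s t : Finset ℕ} (h : Disjoint s t) :
    psgn v (s ∪ t) = psgn v s * psgn v t := by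
  unfold psgn
  rw [filter_union, card_union_of_disjoint (disjoint_filter_filter h), pow_add]

/-- The sign of the shuffle that sorts the juxtaposition of `s` and `t`. -/
def shuffleSign (s t : Finset ℕ) : ℤ := ∏ u ∈ s, psgn u t

theorem shuffleSign_mul_self (s t : Finset ℕ) : shuffleSign s t * shuffleSign s t = 1 := by
  rw [shuffleSign, ← prod_mul_distrib]
  exact prod_eq_one fun u _ => psgn_mul_self u t

theorem shuffleSign_insert_left {w : ℕ} {s : Finset ℕ} (hw : w ∉ s) (t : Finset ℕ) :
    shuffleSign (insert w s) t = psgn w t * shuffleSign s t :=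
  prod_insert hw

theorem psgn_mul_shuffleSign_insert_right {w : ℕ} {s t : Finset ℕ} (hs : w ∉ s) (ht : w ∉ t) :
    psgn w s * shuffleSign s (insert w t) = (-1) ^ s.card * shuffleSign s t := by
  induction s using Finset.induction with
  | empty => simp [psgn, shuffleSign]
  | insert u s hu ih =>
    rw [mem_insert, not_or] at hs
    rw [psgn_insert hu, shuffleSign_insert_left hu, shuffleSign_insert_left hu, psgn_insert ht,
      card_insert_of_notMem hu, pow_succ']
    have : (if u < w then -1 else 1) * (if w < u then -1 else 1) = (-1 : ℤ) := by
      rcases lt_trichotomy u w with h | h | h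
      · simp [h, h.not_gt]
      · exact absurd h.symm hs.1
      · simp [h, h.not_gt]
    linear_combination psgn w s * shuffleSign s (insert w t) * psgn u t * this
      - psgn u t * ih hs.2

/-- The sign in the isomorphism of the tensor product of double complexes with that of a join. -/
def joinSign (x y : Pr) : ℤ :=
  (-1) ^ (x.2.card * y.1.card) * shuffleSign x.1 y.1 * shuffleSign x.2 y.2

theorem joinSign_mul_self (x y : Pr) : joinSign x y * joinSign x y = 1 := by
  have h1 := shuffleSign_mul_self x.1 y.1
  have h2 := shuffleSign_mul_self x.2 y.2
  have h3 : ((-1 : ℤ) ^ (x.2.card * y.1.card)) * (-1) ^ (x.2.card * y.1.card) = 1 := by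
    rw [← mul_pow]; simp
  unfold joinSign
  linear_combination (shuffleSign x.1 y.1) ^ 2 * (shuffleSign x.2 y.2) ^ 2 * h3 +
    (shuffleSign x.2 y.2) ^ 2 * h1 + h2

theorem sum_sum_erase_eq_zero (s : Finset ℕ) (f : ℕ → ℕ → ℤ)
    (hf : ∀ v ∈ s, ∀ w ∈ s, v ≠ w → f v w = -f w v) :
    ∑ v ∈ s, ∑ w ∈ s.erase v, f v w = 0 := by
  have h : ∑ v ∈ s, ∑ w ∈ s.erase v, f v w = ∑ v ∈ s, ∑ w ∈ s.erase v, f w v :=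
    sum_comm' fun v w => by simp only [mem_erase]; tauto
  have h' : ∑ v ∈ s, ∑ w ∈ s.erase v, f w v = -∑ v ∈ s, ∑ w ∈ s.erase v, f v w := by
    simp only [← sum_neg_distrib]
    exact sum_congr rfl fun v hv => sum_congr rfl fun w hw =>
      hf w (mem_of_mem_erase hw) v hv (ne_of_mem_erase hw)
  linarith

theorem ite_lt_antisymm {v w : ℕ} (h : v ≠ w) :
    (if v < w then -1 else 1 : ℤ) = -(if w < v then -1 else 1) := by
  rcases lt_or_gt_of_ne h with h | h <;> simp [h, h.not_gt]

end Signs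

section Differentials

/-- The pairs `σ ⊆ τ` of simplices of `K`. -/
def IsPair (K : SC) (x : Pr) : Prop := x.1 ⊆ x.2 ∧ x.2 ∈ K.faces

variable {K : SC}

theorem IsPair.erase {σ τ : Finset ℕ} (h : K.IsPair (σ, τ)) {w : ℕ} (hw : w ∈ τ \ σ) :
    K.IsPair (σ, τ.erase w) :=
  ⟨subset_erase.mpr ⟨h.1, (mem_sdiff.mp hw).2⟩, K.down_closed h.2 (erase_subset _ _)⟩

theorem IsPair.insert {σ τ : Finset ℕ} (h : K.IsPair (σ, τ)) {v : ℕ} (hv : v ∈ τ \ σ) :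
    K.IsPair (insert v σ, τ) :=
  ⟨insert_subset (mem_sdiff.mp hv).1 h.1, h.2⟩

theorem dvRL_apply (c : Pr → ℤ) {σ τ : Finset ℕ} (h : K.IsPair (σ, τ)) :
    dvRL ℤ K c (σ, τ) = (-1) ^ σ.card * ∑ w ∈ τ \ σ, psgn w τ * c (σ, τ.erase w) := by
  have hh : σ ⊆ τ := h.1
  change dvRF ℤ K c (σ, τ) = _
  rw [dvRF, if_pos ⟨h.2, h.1⟩, smul_eq_mul, sdiff_eq_filter, sum_filter]
  congr 1
  refine sum_congr rfl fun w _ => ?_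
  simp only [subset_erase, hh, true_and, smul_eq_mul]

theorem dhRL_apply (c : Pr → ℤ) {σ τ : Finset ℕ} (h : K.IsPair (σ, τ)) :
    dhRL ℤ K c (σ, τ) = ∑ v ∈ τ \ σ, psgn v σ * c (insert v σ, τ) := by
  change dhRF ℤ K c (σ, τ) = _
  rw [dhRF, if_pos ⟨h.2, h.1⟩]
  exact sum_congr rfl fun v _ => by rw [psgn_insert_self, smul_eq_mul]

theorem dvRL_apply_of_not (c : Pr → ℤ) {x : Pr} (h : ¬ K.IsPair x) : dvRL ℤ K c x = 0 :=
  if_neg fun h' => h ⟨h'.2, h'.1⟩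

theorem dhRL_apply_of_not (c : Pr → ℤ) {x : Pr} (h : ¬ K.IsPair x) : dhRL ℤ K c x = 0 :=
  if_neg fun h' => h ⟨h'.2, h'.1⟩

theorem dvRL_congr {c c' : Pr → ℤ} (h : ∀ x, K.IsPair x → c x = c' x) :
    dvRL ℤ K c = dvRL ℤ K c' := by
  funext ⟨σ, τ⟩
  by_cases hx : K.IsPair (σ, τ)
  · rw [dvRL_apply c hx, dvRL_apply c' hx]
    congr 1
    exact sum_congr rfl fun w hw => by rw [h _ (hx.erase hw)]
  · rw [dvRL_apply_of_not c hx, dvRL_apply_of_not c' hx]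

theorem dhRL_congr {c c' : Pr → ℤ} (h : ∀ x, K.IsPair x → c x = c' x) :
    dhRL ℤ K c = dhRL ℤ K c' := by
  funext ⟨σ, τ⟩
  by_cases hx : K.IsPair (σ, τ)
  · rw [dhRL_apply c hx, dhRL_apply c' hx]
    exact sum_congr rfl fun w hw => by rw [h _ (hx.insert hw)]
  · rw [dhRL_apply_of_not c hx, dhRL_apply_of_not c' hx]

theorem dvRL_dvRL (c : Pr → ℤ) : dvRL ℤ K (dvRL ℤ K c) = 0 := by
  funext ⟨σ, τ⟩
  by_cases hx : K.IsPair (σ, τ)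
  · have : ∑ w ∈ τ \ σ, psgn w τ * dvRL ℤ K c (σ, τ.erase w) = (-1) ^ σ.card *
        ∑ w ∈ τ \ σ, ∑ w' ∈ (τ \ σ).erase w,
          psgn w τ * psgn w' (τ.erase w) * c (σ, (τ.erase w).erase w') := by
      rw [mul_sum]
      refine sum_congr rfl fun w hw => ?_
      rw [dvRL_apply c (hx.erase hw), erase_sdiff_comm, mul_left_comm, mul_sum]
      simp only [mul_assoc]
    rw [dvRL_apply _ hx, this, sum_sum_erase_eq_zero, mul_zero, mul_zero]
    · rfl
    intro v hv w hw hvw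
    have hv' := (mem_sdiff.mp hv).1
    have hw' := (mem_sdiff.mp hw).1
    have h1 : psgn v τ = (if w < v then -1 else 1) * psgn v (τ.erase w) := by
      rw [← psgn_insert (notMem_erase w τ), insert_erase hw']
    have h2 : psgn w τ = (if v < w then -1 else 1) * psgn w (τ.erase v) := by
      rw [← psgn_insert (notMem_erase v τ), insert_erase hv']
    rw [h1, h2, ite_lt_antisymm hvw, erase_right_comm]
    ring
  · exact dvRL_apply_of_not _ hx

theorem dhRL_dhRL (c : Pr → ℤ) : dhRL ℤ K (dhRL ℤ K c) = 0 := by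
  funext ⟨σ, τ⟩
  by_cases hx : K.IsPair (σ, τ)
  · have : ∑ w ∈ τ \ σ, psgn w σ * dhRL ℤ K c (insert w σ, τ) =
        ∑ w ∈ τ \ σ, ∑ w' ∈ (τ \ σ).erase w,
          psgn w σ * psgn w' (insert w σ) * c (insert w' (insert w σ), τ) := by
      refine sum_congr rfl fun w hw => ?_
      rw [dhRL_apply c (hx.insert hw), sdiff_insert, mul_sum]
      simp only [mul_assoc]
    rw [dhRL_apply _ hx, this, sum_sum_erase_eq_zero]
    · rfl
    intro v hv w hw hvw
    rw [psgn_insert (mem_sdiff.mp hv).2, psgn_insert (mem_sdiff.mp hw).2, ite_lt_antisymm hvw,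
      Finset.insert_comm]
    ring
  · exact dhRL_apply_of_not _ hx

theorem dhRL_dvRL (c : Pr → ℤ) : dhRL ℤ K (dvRL ℤ K c) = -dvRL ℤ K (dhRL ℤ K c) := by
  funext ⟨σ, τ⟩
  rw [Pi.neg_apply]
  by_cases hx : K.IsPair (σ, τ)
  · have h1 : ∑ v ∈ τ \ σ, psgn v σ * dvRL ℤ K c (insert v σ, τ) = -((-1) ^ σ.card *
        ∑ v ∈ τ \ σ, ∑ w ∈ (τ \ σ).erase v,
          psgn v σ * psgn w τ * c (insert v σ, τ.erase w)) := by
      rw [mul_sum, ← sum_neg_distrib]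
      refine sum_congr rfl fun v hv => ?_
      rw [dvRL_apply c (hx.insert hv), sdiff_insert, card_insert_of_notMem (mem_sdiff.mp hv).2,
        mul_sum, mul_sum, mul_sum, ← sum_neg_distrib]
      exact sum_congr rfl fun w _ => by ring
    have h2 : ∑ w ∈ τ \ σ, psgn w τ * dhRL ℤ K c (σ, τ.erase w) =
        ∑ w ∈ τ \ σ, ∑ v ∈ (τ \ σ).erase w,
          psgn v σ * psgn w τ * c (insert v σ, τ.erase w) := by
      refine sum_congr rfl fun w hw => ?_
      rw [dhRL_apply c (hx.erase hw), erase_sdiff_comm, mul_sum]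
      exact sum_congr rfl fun v _ => by ring
    rw [dhRL_apply _ hx, dvRL_apply _ hx, h1, h2]
    congr 2
    exact sum_comm' fun v w => by simp only [mem_erase]; tauto
  · rw [dhRL_apply_of_not _ hx, dvRL_apply_of_not _ hx, neg_zero]

end Differentials
end SC

/-! ### Pairs of simplices of a join -/

namespace SC

variable {K L : SC}

theorem subset_verts {s : Finset ℕ} (h : s ∈ K.faces) : s ⊆ K.verts :=
  le_sup (f := id) h

/-- The componentwise union of two pairs. -/
def unionPair (x y : Pr) : Pr := (x.1 ∪ y.1, x.2 ∪ y.2)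

/-- The part of a pair inside `V`. -/
def interPair (V : Finset ℕ) (z : Pr) : Pr := (z.1 ∩ V, z.2 ∩ V)

/-- The part of a pair outside `V`. -/
def sdiffPair (V : Finset ℕ) (z : Pr) : Pr := (z.1 \ V, z.2 \ V)

theorem unionPair_inter_sdiff (V : Finset ℕ) (z : Pr) :
    unionPair (interPair V z) (sdiffPair V z) = z :=
  Prod.ext
    (by ext; simp only [unionPair, interPair, sdiffPair, mem_union, mem_inter, mem_sdiff]; tauto)
    (by ext; simp only [unionPair, interPair, sdiffPair, mem_union, mem_inter, mem_sdiff]; tauto)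

theorem union_inter_of_subset {V s t : Finset ℕ} (hs : s ⊆ V) (ht : Disjoint V t) :
    (s ∪ t) ∩ V = s := by
  rw [union_inter_distrib_right, inter_eq_left.mpr hs, disjoint_iff_inter_eq_empty.mp ht.symm,
    union_empty]

theorem union_sdiff_of_subset {V s t : Finset ℕ} (hs : s ⊆ V) (ht : Disjoint V t) :
    (s ∪ t) \ V = t := by
  rw [union_sdiff_distrib, sdiff_eq_empty_iff_subset.mpr hs, sdiff_eq_self_of_disjoint ht.symm,
    empty_union]

theorem IsPair.subset_verts {x : Pr} (h : K.IsPair x) : x.2 ⊆ K.verts := SC.subset_verts h.2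

theorem IsPair.disjoint_verts (hdisj : Disjoint K.verts L.verts) {y : Pr} (h : L.IsPair y) :
    Disjoint K.verts y.2 :=
  hdisj.mono_right h.subset_verts

theorem IsPair.interPair_union (hdisj : Disjoint K.verts L.verts) {x y : Pr} (hx : K.IsPair x)
    (hy : L.IsPair y) : interPair K.verts (unionPair x y) = x :=
  have h := hy.disjoint_verts hdisj
  Prod.ext (union_inter_of_subset (hx.1.trans hx.subset_verts) (h.mono_right hy.1))
    (union_inter_of_subset hx.subset_verts h)

theorem IsPair.sdiffPair_union (hdisj : Disjoint K.verts L.verts) {x y : Pr} (hx : K.IsPair x)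
    (hy : L.IsPair y) : sdiffPair K.verts (unionPair x y) = y :=
  have h := hy.disjoint_verts hdisj
  Prod.ext (union_sdiff_of_subset (hx.1.trans hx.subset_verts) (h.mono_right hy.1))
    (union_sdiff_of_subset hx.subset_verts h)

theorem IsPair.union {x y : Pr} (hx : K.IsPair x) (hy : L.IsPair y) :
    (K.join L).IsPair (unionPair x y) :=
  ⟨union_subset_union hx.1 hy.1, mem_image.mpr ⟨(x.2, y.2), mem_product.mpr ⟨hx.2, hy.2⟩, rfl⟩⟩

theorem IsPair.exists_union {z : Pr} (hdisj : Disjoint K.verts L.verts)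
    (hz : (K.join L).IsPair z) :
    K.IsPair (interPair K.verts z) ∧ L.IsPair (sdiffPair K.verts z) := by
  obtain ⟨h1, h2⟩ := hz
  obtain ⟨⟨s, t⟩, hst, h⟩ := mem_image.mp h2
  obtain ⟨hs, ht⟩ := mem_product.mp hst
  change s ∪ t = z.2 at h
  have hd := hdisj.mono_right (SC.subset_verts ht)
  refine ⟨⟨inter_subset_inter_right h1, ?_⟩, ⟨sdiff_subset_sdiff h1 subset_rfl, ?_⟩⟩
  · rw [interPair, ← h, union_inter_of_subset (SC.subset_verts hs) hd]
    exact hs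
  · rw [sdiffPair, ← h, union_sdiff_of_subset (SC.subset_verts hs) hd]
    exact ht

/-- The cross product of two functions on pairs, with signs. -/
def joinFun (V : Finset ℕ) (a b : Pr → ℤ) : Pr → ℤ := fun z =>
  joinSign (interPair V z) (sdiffPair V z) * (a (interPair V z) * b (sdiffPair V z))

theorem joinFun_union (hdisj : Disjoint K.verts L.verts) (a b : Pr → ℤ) {x y : Pr}
    (hx : K.IsPair x) (hy : L.IsPair y) :
    joinFun K.verts a b (unionPair x y) = joinSign x y * (a x * b y) := by
  rw [joinFun, hx.interPair_union hdisj hy, hx.sdiffPair_union hdisj hy]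

theorem disjoint_of_isPair (hdisj : Disjoint K.verts L.verts) {x y : Pr} (hx : K.IsPair x)
    (hy : L.IsPair y) : Disjoint x.2 y.2 :=
  hdisj.mono hx.subset_verts hy.subset_verts

theorem union_sdiff_union {s t s' t' : Finset ℕ} (h : Disjoint t t') (hs : s ⊆ t) (hs' : s' ⊆ t') :
    (t ∪ t') \ (s ∪ s') = (t \ s) ∪ (t' \ s') := by
  ext u
  have h1 : u ∈ t → u ∉ t' := fun hu => disjoint_left.mp h hu
  have h2 := @hs u
  have h3 := @hs' u
  simp only [mem_sdiff, mem_union]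
  tauto

theorem dvRL_joinFun (hdisj : Disjoint K.verts L.verts) (a b : Pr → ℤ) {x y : Pr}
    (hx : K.IsPair x) (hy : L.IsPair y) :
    dvRL ℤ (K.join L) (joinFun K.verts a b) (unionPair x y) = joinSign x y *
      (dvRL ℤ K a x * b y + (-1) ^ (x.1.card + x.2.card) * a x * dvRL ℤ L b y) := by
  obtain ⟨σ, τ⟩ := x
  obtain ⟨σ', τ'⟩ := y
  have hd : Disjoint τ τ' := disjoint_of_isPair hdisj hx hy
  have hσ : σ ⊆ τ := hx.1
  have hσ' : σ' ⊆ τ' := hy.1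
  rw [unionPair, dvRL_apply _ (hx.union hy), dvRL_apply _ hx, dvRL_apply _ hy,
    card_union_of_disjoint (hd.mono hσ hσ'), union_sdiff_union hd hσ hσ',
    sum_union (hd.mono sdiff_subset sdiff_subset)]
  have h1 : ∑ w ∈ τ \ σ, psgn w (τ ∪ τ') *
        joinFun K.verts a b (σ ∪ σ', (τ ∪ τ').erase w) =
      (-1) ^ σ'.card * joinSign (σ, τ) (σ', τ') *
        ((∑ w ∈ τ \ σ, psgn w τ * a (σ, τ.erase w)) * b (σ', τ')) := by
    rw [sum_mul, mul_sum]
    refine sum_congr rfl fun w hw => ?_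
    have hwτ := (mem_sdiff.mp hw).1
    have hwτ' := disjoint_left.mp hd hwτ
    have e1 : (τ ∪ τ').erase w = τ.erase w ∪ τ' := by
      rw [erase_union_distrib, erase_eq_of_notMem hwτ']
    have e2 := joinFun_union hdisj a b (hx.erase hw) hy
    rw [unionPair] at e2
    rw [e1, e2, psgn_union w hd]
    have e3 : shuffleSign τ τ' = psgn w τ' * shuffleSign (τ.erase w) τ' := by
      rw [← shuffleSign_insert_left (notMem_erase w τ), insert_erase hwτ]
    have e4 : (-1 : ℤ) ^ (τ.card * σ'.card) =
        (-1) ^ σ'.card * (-1) ^ ((τ.erase w).card * σ'.card) := by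
      rw [← pow_add, ← card_erase_add_one hwτ]
      congr 1
      ring
    have e5 : ((-1 : ℤ) ^ σ'.card) * (-1) ^ σ'.card = 1 := by rw [← mul_pow]; simp
    simp only [joinSign, e3, e4]
    linear_combination -(psgn w τ * psgn w τ' * (-1) ^ ((τ.erase w).card * σ'.card) *
      shuffleSign σ σ' * shuffleSign (τ.erase w) τ' * a (σ, τ.erase w) * b (σ', τ')) * e5
  have h2 : ∑ w ∈ τ' \ σ', psgn w (τ ∪ τ') *
        joinFun K.verts a b (σ ∪ σ', (τ ∪ τ').erase w) =
      (-1) ^ τ.card * joinSign (σ, τ) (σ', τ') *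
        (a (σ, τ) * (∑ w ∈ τ' \ σ', psgn w τ' * b (σ', τ'.erase w))) := by
    rw [mul_sum, mul_sum]
    refine sum_congr rfl fun w hw => ?_
    have hwτ' := (mem_sdiff.mp hw).1
    have hwτ := disjoint_right.mp hd hwτ'
    have e1 : (τ ∪ τ').erase w = τ ∪ τ'.erase w := by
      rw [erase_union_distrib, erase_eq_of_notMem hwτ]
    have e2 := joinFun_union hdisj a b hx (hy.erase hw)
    rw [unionPair] at e2
    rw [e1, e2, psgn_union w hd]
    have e3 := psgn_mul_shuffleSign_insert_right hwτ (notMem_erase w τ')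
    rw [insert_erase hwτ'] at e3
    have e4 := psgn_mul_self w τ
    have e5 : ((-1 : ℤ) ^ τ.card) * (-1) ^ τ.card = 1 := by rw [← mul_pow]; simp
    simp only [joinSign]
    linear_combination a (σ, τ) * b (σ', τ'.erase w) * shuffleSign σ σ' *
      (-1) ^ (τ.card * σ'.card) * psgn w τ' * (-(psgn w τ * (-1) ^ τ.card) * e3 +
        (-1) ^ τ.card * shuffleSign τ τ' * e4 - psgn w τ * shuffleSign τ (τ'.erase w) * e5)
  rw [h1, h2]
  simp only [pow_add]
  have e5 : ((-1 : ℤ) ^ σ'.card) * (-1) ^ σ'.card = 1 := by rw [← mul_pow]; simp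
  linear_combination (-1) ^ σ.card * joinSign (σ, τ) (σ', τ') *
    ((∑ w ∈ τ \ σ, psgn w τ * a (σ, τ.erase w)) * b (σ', τ')) * e5

theorem dhRL_joinFun (hdisj : Disjoint K.verts L.verts) (a b : Pr → ℤ) {x y : Pr}
    (hx : K.IsPair x) (hy : L.IsPair y) :
    dhRL ℤ (K.join L) (joinFun K.verts a b) (unionPair x y) = joinSign x y *
      (dhRL ℤ K a x * b y + (-1) ^ (x.1.card + x.2.card) * a x * dhRL ℤ L b y) := by
  obtain ⟨σ, τ⟩ := x
  obtain ⟨σ', τ'⟩ := y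
  have hd : Disjoint τ τ' := disjoint_of_isPair hdisj hx hy
  have hσ : σ ⊆ τ := hx.1
  have hσ' : σ' ⊆ τ' := hy.1
  have hdσ := hd.mono hσ hσ'
  rw [unionPair, dhRL_apply _ (hx.union hy), dhRL_apply _ hx, dhRL_apply _ hy,
    union_sdiff_union hd hσ hσ', sum_union (hd.mono sdiff_subset sdiff_subset), mul_add, sum_mul,
    mul_sum, mul_sum, mul_sum]
  congr 1
  · refine sum_congr rfl fun v hv => ?_
    obtain ⟨hvτ, hvσ⟩ := mem_sdiff.mp hv
    have e2 := joinFun_union hdisj a b (hx.insert hv) hy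
    rw [unionPair] at e2
    rw [← insert_union, e2, psgn_union v hdσ]
    have e4 := psgn_mul_self v σ'
    simp only [joinSign, shuffleSign_insert_left hvσ]
    linear_combination (psgn v σ * (-1) ^ (τ.card * σ'.card) * shuffleSign σ σ' *
      shuffleSign τ τ' * a (insert v σ, τ) * b (σ', τ')) * e4
  · refine sum_congr rfl fun v hv => ?_
    obtain ⟨hvτ', hvσ'⟩ := mem_sdiff.mp hv
    have hvσ : v ∉ σ := fun h => disjoint_right.mp hd hvτ' (hσ h)
    have e2 := joinFun_union hdisj a b hx (hy.insert hv)
    rw [unionPair] at e2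
    rw [← union_insert, e2, psgn_union v hdσ]
    have e3 := psgn_mul_shuffleSign_insert_right hvσ hvσ'
    simp only [joinSign, card_insert_of_notMem hvσ', mul_add, pow_add, mul_one]
    linear_combination (psgn v σ' * (-1) ^ (τ.card * σ'.card) * (-1) ^ τ.card *
      shuffleSign τ τ' * a (σ, τ) * b (insert v σ', τ')) * e3

end SC

/-! ### The double complex as a finite free module -/

namespace SC
open TensorProduct DiffModule

local instance (M N : Type*) [AddCommGroup M] [AddCommGroup N] [Module ℤ M] [Module ℤ N] :
    Module ℤ (M ⊗[ℤ] N) := TensorProduct.instModule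

variable {K L : SC}

/-- Integral functions on the pairs `σ ⊆ τ` of simplices of `K`. -/
abbrev PairFun (K : SC) : Type := {x : Pr // K.IsPair x} → ℤ

instance (K : SC) : Finite {x : Pr // K.IsPair x} :=
  Set.Finite.subset (K.faces ×ˢ K.faces).finite_toSet fun _ hx =>
    mem_coe.mpr (mem_product.mpr ⟨K.down_closed hx.2 hx.1, hx.2⟩)

/-- Restriction of functions to the pairs of `K`. -/
def res (K : SC) : (Pr → ℤ) →ₗ[ℤ] PairFun K := LinearMap.funLeft ℤ ℤ Subtype.val

/-- Extension by zero of functions on the pairs of `K`. -/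
noncomputable def ext₀ (K : SC) : PairFun K →ₗ[ℤ] (Pr → ℤ) :=
  Function.ExtendByZero.linearMap ℤ Subtype.val

theorem res_apply (c : Pr → ℤ) (x : {x : Pr // K.IsPair x}) : res K c x = c x := rfl

theorem ext₀_apply (a : PairFun K) (x : {x : Pr // K.IsPair x}) : ext₀ K a x = a x :=
  Subtype.val_injective.extend_apply a (0 : Pr → ℤ) x

theorem ext₀_apply_of_not (a : PairFun K) {x : Pr} (hx : ¬ K.IsPair x) : ext₀ K a x = 0 :=
  Function.extend_apply' a (0 : Pr → ℤ) x fun ⟨y, hy⟩ => hx (hy ▸ y.2)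

theorem res_ext₀ (a : PairFun K) : res K (ext₀ K a) = a := funext fun x => ext₀_apply a x

theorem ext₀_res_apply (c : Pr → ℤ) {x : Pr} (hx : K.IsPair x) : ext₀ K (res K c) x = c x :=
  ext₀_apply (res K c) ⟨x, hx⟩

theorem ext₀_res (c : Pr → ℤ) (hc : ∀ x, c x ≠ 0 → K.IsPair x) : ext₀ K (res K c) = c := by
  funext x
  by_cases hx : K.IsPair x
  · exact ext₀_res_apply c hx
  · rw [ext₀_apply_of_not _ hx]
    by_contra h
    exact hx (hc x (Ne.symm h))

/-- The vertical differential. -/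
noncomputable def dvM (K : SC) : PairFun K →ₗ[ℤ] PairFun K := res K ∘ₗ dvRL ℤ K ∘ₗ ext₀ K

/-- The horizontal differential. -/
noncomputable def dhM (K : SC) : PairFun K →ₗ[ℤ] PairFun K := res K ∘ₗ dhRL ℤ K ∘ₗ ext₀ K

theorem dvM_res (c : Pr → ℤ) : dvM K (res K c) = res K (dvRL ℤ K c) :=
  congrArg (res K) (dvRL_congr fun _ hx => ext₀_res_apply c hx)

theorem dhM_res (c : Pr → ℤ) : dhM K (res K c) = res K (dhRL ℤ K c) :=
  congrArg (res K) (dhRL_congr fun _ hx => ext₀_res_apply c hx)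

theorem ext₀_dvM (a : PairFun K) : ext₀ K (dvM K a) = dvRL ℤ K (ext₀ K a) :=
  ext₀_res _ fun _ hx => by_contra fun h => hx (dvRL_apply_of_not _ h)

theorem ext₀_dhM (a : PairFun K) : ext₀ K (dhM K a) = dhRL ℤ K (ext₀ K a) :=
  ext₀_res _ fun _ hx => by_contra fun h => hx (dhRL_apply_of_not _ h)

theorem dvM_comp_dvM (K : SC) : dvM K ∘ₗ dvM K = 0 := LinearMap.ext fun a => by
  change res K (dvRL ℤ K (ext₀ K (dvM K a))) = 0
  rw [ext₀_dvM, dvRL_dvRL, map_zero]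

theorem dhM_comp_dhM (K : SC) : dhM K ∘ₗ dhM K = 0 := LinearMap.ext fun a => by
  change res K (dhRL ℤ K (ext₀ K (dhM K a))) = 0
  rw [ext₀_dhM, dhRL_dhRL, map_zero]

theorem dhM_comp_dvM (K : SC) : dhM K ∘ₗ dvM K = -(dvM K ∘ₗ dhM K) := LinearMap.ext fun a => by
  change res K (dhRL ℤ K (ext₀ K (dvM K a))) = -res K (dvRL ℤ K (ext₀ K (dhM K a)))
  rw [ext₀_dvM, ext₀_dhM, dhRL_dvRL, map_neg]

/-- The sign involution `(-1)^{|σ| + |τ|}`. -/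
def signM (K : SC) : PairFun K →ₗ[ℤ] PairFun K where
  toFun a x := (-1) ^ (x.val.1.card + x.val.2.card) * a x
  map_add' _ _ := funext fun _ => mul_add _ _ _
  map_smul' _ _ := funext fun _ => mul_left_comm _ _ _

theorem signM_apply (a : PairFun K) (x : {x : Pr // K.IsPair x}) :
    signM K a x = (-1) ^ (x.val.1.card + x.val.2.card) * a x := rfl

theorem signM_comp_signM (K : SC) : signM K ∘ₗ signM K = LinearMap.id :=
  LinearMap.ext fun a => funext fun x => by
    change (-1) ^ _ * ((-1) ^ _ * a x) = a x
    rw [← mul_assoc, ← mul_pow]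
    simp

theorem dvM_apply (a : PairFun K) (x : {x : Pr // K.IsPair x}) :
    dvM K a x = (-1) ^ x.val.1.card * ∑ w ∈ x.val.2 \ x.val.1,
      psgn w x.val.2 * ext₀ K a (x.val.1, x.val.2.erase w) :=
  dvRL_apply _ x.2

theorem dhM_apply (a : PairFun K) (x : {x : Pr // K.IsPair x}) :
    dhM K a x = ∑ v ∈ x.val.2 \ x.val.1,
      psgn v x.val.1 * ext₀ K a (insert v x.val.1, x.val.2) :=
  dhRL_apply _ x.2

theorem ext₀_signM (a : PairFun K) (x : Pr) :
    ext₀ K (signM K a) x = (-1) ^ (x.1.card + x.2.card) * ext₀ K a x := by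
  by_cases hx : K.IsPair x
  · rw [ext₀_apply _ ⟨x, hx⟩, ext₀_apply _ ⟨x, hx⟩, signM_apply]
  · rw [ext₀_apply_of_not _ hx, ext₀_apply_of_not _ hx, mul_zero]

theorem signM_comp_dvM (K : SC) : signM K ∘ₗ dvM K = -(dvM K ∘ₗ signM K) :=
  LinearMap.ext fun a => funext fun x => by
    change signM K (dvM K a) x = -(dvM K (signM K a) x)
    rw [signM_apply, dvM_apply, dvM_apply, mul_left_comm, ← mul_neg, mul_sum, ← sum_neg_distrib]
    congr 1
    refine sum_congr rfl fun w hw => ?_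
    rw [ext₀_signM, ← card_erase_add_one (mem_sdiff.mp hw).1]
    ring

theorem signM_comp_dhM (K : SC) : signM K ∘ₗ dhM K = -(dhM K ∘ₗ signM K) :=
  LinearMap.ext fun a => funext fun x => by
    change signM K (dhM K a) x = -(dhM K (signM K a) x)
    rw [signM_apply, dhM_apply, dhM_apply, mul_sum, ← sum_neg_distrib]
    refine sum_congr rfl fun w hw => ?_
    rw [ext₀_signM, card_insert_of_notMem (mem_sdiff.mp hw).2]
    ring

/-- Functions on pairs of a join, as functions of two pairs. -/
noncomputable def joinCurry (hdisj : Disjoint K.verts L.verts) :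
    ({y : Pr // L.IsPair y} → PairFun K) ≃ₗ[ℤ] PairFun (K.join L) where
  toFun f z := joinSign (interPair K.verts z.val) (sdiffPair K.verts z.val) *
    f ⟨_, (z.2.exists_union hdisj).2⟩ ⟨_, (z.2.exists_union hdisj).1⟩
  map_add' _ _ := funext fun _ => mul_add _ _ _
  map_smul' _ _ := funext fun _ => mul_left_comm _ _ _
  invFun g y x := joinSign x.val y.val * g ⟨unionPair x.val y.val, x.2.union y.2⟩
  left_inv f := by
    funext y x
    have h1 := x.2.interPair_union hdisj y.2
    have h2 := x.2.sdiffPair_union hdisj y.2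
    simp only [h1, h2, ← mul_assoc, joinSign_mul_self, one_mul]
  right_inv g := by
    funext z
    simp only [unionPair_inter_sdiff, ← mul_assoc, joinSign_mul_self, one_mul]

/-- The isomorphism of the tensor product of double complexes with that of the join. -/
noncomputable def joinEquiv (hdisj : Disjoint K.verts L.verts) :
    PairFun K ⊗[ℤ] PairFun L ≃ₗ[ℤ] PairFun (K.join L) :=
  have := Fintype.ofFinite {y : Pr // L.IsPair y}
  have := Classical.decEq {y : Pr // L.IsPair y}
  TensorProduct.piScalarRight ℤ ℤ (PairFun K) {y : Pr // L.IsPair y} ≪≫ₗ joinCurry hdisj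

theorem joinEquiv_tmul (hdisj : Disjoint K.verts L.verts) (a : PairFun K) (b : PairFun L) :
    joinEquiv hdisj (a ⊗ₜ b) = res _ (joinFun K.verts (ext₀ K a) (ext₀ L b)) := by
  funext z
  obtain ⟨hx, hy⟩ := z.2.exists_union hdisj
  rw [res_apply, joinFun, ext₀_apply a ⟨_, hx⟩, ext₀_apply b ⟨_, hy⟩, mul_comm (a _)]
  let := Fintype.ofFinite {y : Pr // L.IsPair y}
  let := Classical.decEq {y : Pr // L.IsPair y}
  change joinSign _ _ * (TensorProduct.piScalarRight ℤ ℤ (PairFun K) {y : Pr // L.IsPair y}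
    (a ⊗ₜ b)) ⟨_, hy⟩ ⟨_, hx⟩ = _
  rw [TensorProduct.piScalarRight_apply, TensorProduct.piScalarRightHom_tmul]
  rfl

theorem joinEquiv_comp_dvM (hdisj : Disjoint K.verts L.verts) :
    (joinEquiv hdisj).toLinearMap ∘ₗ tensorDiff (dvM K) (signM K) (dvM L) =
      dvM (K.join L) ∘ₗ (joinEquiv hdisj).toLinearMap := by
  refine TensorProduct.ext' fun a b => funext fun z => ?_
  obtain ⟨hx, hy⟩ := z.2.exists_union hdisj
  simp only [LinearMap.comp_apply, LinearEquiv.coe_coe, tensorDiff_tmul, map_add, joinEquiv_tmul,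
    dvM_res, Pi.add_apply, res_apply]
  rw [← unionPair_inter_sdiff K.verts z.val, dvRL_joinFun hdisj _ _ hx hy,
    joinFun_union hdisj _ _ hx hy, joinFun_union hdisj _ _ hx hy, ext₀_dvM, ext₀_dvM, ext₀_signM]
  ring

theorem joinEquiv_comp_dhM (hdisj : Disjoint K.verts L.verts) :
    (joinEquiv hdisj).toLinearMap ∘ₗ tensorDiff (dhM K) (signM K) (dhM L) =
      dhM (K.join L) ∘ₗ (joinEquiv hdisj).toLinearMap := by
  refine TensorProduct.ext' fun a b => funext fun z => ?_
  obtain ⟨hx, hy⟩ := z.2.exists_union hdisj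
  simp only [LinearMap.comp_apply, LinearEquiv.coe_coe, tensorDiff_tmul, map_add, joinEquiv_tmul,
    dhM_res, Pi.add_apply, res_apply]
  rw [← unionPair_inter_sdiff K.verts z.val, dhRL_joinFun hdisj _ _ hx hy,
    joinFun_union hdisj _ _ hx hy, joinFun_union hdisj _ _ hx hy, ext₀_dhM, ext₀_dhM, ext₀_signM]
  ring

/-! ### Bidegrees -/

local instance (M : Type*) [AddCommGroup M] [Module ℤ M] (P : Submodule ℤ M) : Module ℤ (M ⧸ P) :=
  Submodule.Quotient.module P

/-- The bidegree of a pair of simplices. -/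
def bideg (x : Pr) : ℤ × ℤ := (x.1.card - 1, x.2.card - 1)

theorem mem_NgrR_iff {p q : ℤ} {c : Pr → ℤ} :
    c ∈ NgrR ℤ K p q ↔ ∀ x, c x ≠ 0 → K.IsPair x ∧ bideg x = (p, q) := by
  refine forall₂_congr fun x _ => ?_
  rw [IsPair, bideg, Prod.mk.injEq, sub_eq_iff_eq_add, sub_eq_iff_eq_add]
  tauto

open Classical in
/-- The component of a function in a given bidegree. -/
noncomputable def part (K : SC) (i : ℤ × ℤ) : (Pr → ℤ) →ₗ[ℤ] (Pr → ℤ) where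
  toFun c x := if K.IsPair x ∧ bideg x = i then c x else 0
  map_add' _ _ := funext fun x => by
    simp only [Pi.add_apply]
    split_ifs <;> simp
  map_smul' _ _ := funext fun x => by simp

theorem part_apply_of (c : Pr → ℤ) {i : ℤ × ℤ} {x : Pr} (h : K.IsPair x) (hi : bideg x = i) :
    part K i c x = c x := if_pos ⟨h, hi⟩

theorem part_apply_of_not (c : Pr → ℤ) {i : ℤ × ℤ} {x : Pr} (h : K.IsPair x → bideg x ≠ i) :
    part K i c x = 0 := if_neg fun h' => h h'.1 h'.2

theorem part_apply_of_eq_zero {c : Pr → ℤ} {i : ℤ × ℤ} {x : Pr} (hx : c x = 0) :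
    part K i c x = 0 := by
  by_cases h : K.IsPair x ∧ bideg x = i
  · exact (if_pos h).trans hx
  · exact if_neg h

theorem part_mem (c : Pr → ℤ) (i : ℤ × ℤ) : part K i c ∈ NgrR ℤ K i.1 i.2 :=
  mem_NgrR_iff.mpr fun x hx => by
    by_contra h
    exact hx (if_neg h)

theorem part_eq_self {c : Pr → ℤ} {i : ℤ × ℤ} (h : c ∈ NgrR ℤ K i.1 i.2) : part K i c = c := by
  funext x
  by_cases hx : c x = 0
  · rw [hx]
    exact part_apply_of_eq_zero hx
  · obtain ⟨h1, h2⟩ := mem_NgrR_iff.mp h x hx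
    exact part_apply_of c h1 h2

theorem part_eq_zero {c : Pr → ℤ} {i j : ℤ × ℤ} (h : c ∈ NgrR ℤ K i.1 i.2) (hij : i ≠ j) :
    part K j c = 0 := by
  funext x
  by_cases hx : c x = 0
  · exact part_apply_of_eq_zero hx
  · obtain ⟨_, h2⟩ := mem_NgrR_iff.mp h x hx
    exact part_apply_of_not c fun _ h3 => hij (h2.symm.trans h3)

theorem ext₀_res_of_mem {c : Pr → ℤ} {p q : ℤ} (h : c ∈ NgrR ℤ K p q) :
    ext₀ K (res K c) = c :=
  ext₀_res c fun x hx => (mem_NgrR_iff.mp h x hx).1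

theorem bideg_erase {σ τ : Finset ℕ} {w : ℕ} (hw : w ∈ τ) (p q : ℤ) :
    bideg (σ, τ.erase w) = (p, q - 1) ↔ bideg (σ, τ) = (p, q) := by
  have := card_erase_add_one hw
  simp only [bideg, Prod.mk.injEq]
  omega

theorem bideg_insert {σ τ : Finset ℕ} {v : ℕ} (hv : v ∉ σ) (p q : ℤ) :
    bideg (insert v σ, τ) = (p, q) ↔ bideg (σ, τ) = (p - 1, q) := by
  have := card_insert_of_notMem hv
  simp only [bideg, Prod.mk.injEq]
  omega

theorem dvRL_part (c : Pr → ℤ) (p q : ℤ) :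
    dvRL ℤ K (part K (p, q - 1) c) = part K (p, q) (dvRL ℤ K c) := by
  funext ⟨σ, τ⟩
  by_cases hx : K.IsPair (σ, τ)
  · rw [dvRL_apply _ hx]
    by_cases hi : bideg (σ, τ) = (p, q)
    · rw [part_apply_of _ hx hi, dvRL_apply _ hx]
      congr 1
      refine sum_congr rfl fun w hw => ?_
      rw [part_apply_of _ (hx.erase hw) ((bideg_erase (mem_sdiff.mp hw).1 p q).mpr hi)]
    · rw [part_apply_of_not _ fun _ => hi, sum_eq_zero, mul_zero]
      intro w hw
      rw [part_apply_of_not _ fun _ h => hi ((bideg_erase (mem_sdiff.mp hw).1 p q).mp h), mul_zero]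
  · rw [dvRL_apply_of_not _ hx, part_apply_of_not _ fun h => absurd h hx]

theorem dhRL_part (c : Pr → ℤ) (p q : ℤ) :
    dhRL ℤ K (part K (p, q) c) = part K (p - 1, q) (dhRL ℤ K c) := by
  funext ⟨σ, τ⟩
  by_cases hx : K.IsPair (σ, τ)
  · rw [dhRL_apply _ hx]
    by_cases hi : bideg (σ, τ) = (p - 1, q)
    · rw [part_apply_of _ hx hi, dhRL_apply _ hx]
      refine sum_congr rfl fun w hw => ?_
      rw [part_apply_of _ (hx.insert hw) ((bideg_insert (mem_sdiff.mp hw).2 p q).mpr hi)]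
    · rw [part_apply_of_not _ fun _ => hi, sum_eq_zero]
      intro w hw
      rw [part_apply_of_not _ fun _ h => hi ((bideg_insert (mem_sdiff.mp hw).2 p q).mp h), mul_zero]
  · rw [dhRL_apply_of_not _ hx, part_apply_of_not _ fun h => absurd h hx]

theorem exists_sum_part (K : SC) : ∃ S : Finset (ℤ × ℤ), ∀ a : PairFun K,
    ∑ i ∈ S, part K i (ext₀ K a) = ext₀ K a := by
  have := Fintype.ofFinite {x : Pr // K.IsPair x}
  refine ⟨univ.image fun x : {x : Pr // K.IsPair x} => bideg x, fun a => ?_⟩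
  funext x
  rw [Finset.sum_apply]
  by_cases hx : K.IsPair x
  · rw [sum_eq_single (bideg x), part_apply_of _ hx rfl]
    · exact fun i _ hi => part_apply_of_not _ fun _ h => hi h.symm
    · exact fun h => absurd (mem_image_of_mem _ (mem_univ (⟨x, hx⟩ : {x : Pr // K.IsPair x}))) h
  · rw [ext₀_apply_of_not _ hx]
    exact sum_eq_zero fun i _ => part_apply_of_not _ fun h => absurd h hx

theorem res_mem_secondCycles {p q : ℤ} {z : Pr → ℤ} (hz : z ∈ Z2R ℤ K p q) :
    res K z ∈ secondCycles (dvM K) (dhM K) := by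
  obtain ⟨⟨_, hz⟩, y, _, hy⟩ := hz
  refine ⟨?_, res K y, ?_⟩
  · exact (dvM_res z).trans ((congrArg (res K) hz).trans (map_zero _))
  · rw [dvM_res, hy, dhM_res]

theorem part_mem_Z2R {z : PairFun K} (hz : z ∈ secondCycles (dvM K) (dhM K)) (i : ℤ × ℤ) :
    part K i (ext₀ K z) ∈ Z2R ℤ K i.1 i.2 := by
  obtain ⟨p, q⟩ := i
  obtain ⟨hz, y, hy⟩ := hz
  refine ⟨⟨part_mem _ _, ?_⟩, part K (p - 1, q - 1) (ext₀ K y), part_mem _ _, ?_⟩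
  · have := dvRL_part (K := K) (ext₀ K z) p (q + 1)
    rw [add_sub_cancel_right] at this
    exact this.trans (by rw [← ext₀_dvM, LinearMap.mem_ker.mp hz, map_zero, map_zero])
  · rw [dvRL_part, dhRL_part, ← ext₀_dvM, ← ext₀_dhM, hy]

theorem res_mem_secondBoundaries {p q : ℤ} {z : Pr → ℤ} (hz : z ∈ B2R ℤ K p q) :
    res K z ∈ secondBoundaries (dvM K) (dhM K) := by
  obtain ⟨_, ⟨y, _, rfl⟩, _, ⟨w, ⟨_, hw⟩, rfl⟩, rfl⟩ := Submodule.mem_sup.mp hz.1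
  rw [map_add, ← dvM_res, ← dhM_res]
  refine add_mem (Submodule.mem_sup_left ⟨_, rfl⟩) (Submodule.mem_sup_right ⟨_, ?_, rfl⟩)
  exact (dvM_res w).trans ((congrArg (res K) hw).trans (map_zero _))

theorem part_mem_B2R {z : PairFun K} (hz : z ∈ secondBoundaries (dvM K) (dhM K)) (i : ℤ × ℤ) :
    part K i (ext₀ K z) ∈ B2R ℤ K i.1 i.2 := by
  obtain ⟨p, q⟩ := i
  refine ⟨?_, part_mem _ _⟩
  obtain ⟨_, ⟨y, rfl⟩, _, ⟨w, hw, rfl⟩, rfl⟩ := Submodule.mem_sup.mp hz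
  have h1 := dvRL_part (K := K) (ext₀ K y) p q
  have h2 := dhRL_part (K := K) (ext₀ K w) (p + 1) q
  have h3 := dvRL_part (K := K) (ext₀ K w) (p + 1) (q + 1)
  rw [add_sub_cancel_right] at h2 h3
  rw [map_add, map_add, ext₀_dvM, ext₀_dhM, ← h1, ← h2]
  refine add_mem (Submodule.mem_sup_left ⟨_, part_mem _ _, rfl⟩)
    (Submodule.mem_sup_right ⟨_, ⟨part_mem _ _, ?_⟩, rfl⟩)
  exact h3.trans (by rw [← ext₀_dvM, LinearMap.mem_ker.mp hw, map_zero, map_zero])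

/-- The class of a cycle in reduced cohomeology. -/
abbrev clsHHR (K : SC) (p q : ℤ) : Z2R ℤ K p q →ₗ[ℤ] HHR ℤ K p q :=
  ((B2R ℤ K p q).submoduleOf (Z2R ℤ K p q)).mkQ

theorem clsHHR_surjective (K : SC) (p q : ℤ) : Function.Surjective (clsHHR K p q) :=
  Submodule.mkQ_surjective _

/-- The second page of the reduced double complex, without gradings. -/
abbrev TotalHHR (K : SC) : Type := SecondPage (dvM K) (dhM K)

/-- The inclusion of a bidegree in the second page. -/
noncomputable def incHHR (K : SC) (i : ℤ × ℤ) : HHR ℤ K i.1 i.2 →ₗ[ℤ] TotalHHR K :=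
  Submodule.mapQ _ _ ((res K).restrict fun _ => res_mem_secondCycles) fun _ =>
    res_mem_secondBoundaries

/-- The projection of the second page to a bidegree. -/
noncomputable def projHHR (K : SC) (i : ℤ × ℤ) : TotalHHR K →ₗ[ℤ] HHR ℤ K i.1 i.2 :=
  Submodule.mapQ _ _ ((part K i ∘ₗ ext₀ K).restrict fun _ hz => part_mem_Z2R hz i) fun _ hz =>
    part_mem_B2R hz i

theorem splitting_HHR (K : SC) :
    Splitting (R := ℤ) (fun i : ℤ × ℤ => HHR ℤ K i.1 i.2) (TotalHHR K) (incHHR K) (projHHR K) where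
  pr_inc_self i a := by
    obtain ⟨z, rfl⟩ := clsHHR_surjective _ _ _ a
    refine congrArg (clsHHR K i.1 i.2) (Subtype.ext ?_)
    change part K i (ext₀ K (res K z)) = z
    rw [ext₀_res_of_mem z.2.1.1, part_eq_self z.2.1.1]
  pr_inc_of_ne i i' h a := by
    obtain ⟨z, rfl⟩ := clsHHR_surjective _ _ _ a
    refine (congrArg (clsHHR K i'.1 i'.2) (Subtype.ext ?_)).trans (map_zero _)
    change part K i' (ext₀ K (res K z)) = 0
    rw [ext₀_res_of_mem z.2.1.1, part_eq_zero z.2.1.1 h]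
  exists_sum := by
    obtain ⟨S, hS⟩ := exists_sum_part K
    refine ⟨S, fun x => ?_⟩
    obtain ⟨z, rfl⟩ := cls₂_surjective _ _ x
    change ∑ i ∈ S, cls₂ (dvM K) (dhM K) ⟨res K (part K i (ext₀ K z)), _⟩ = cls₂ _ _ z
    rw [← map_sum]
    refine congrArg (cls₂ _ _) (Subtype.ext ?_)
    rw [AddSubmonoidClass.coe_finsetSum, ← map_sum, hS, res_ext₀]

/-! ### The Künneth theorem for joins -/

open DirectSum

theorem isTorsionFree_homology_dvM (h : ∀ p q : ℤ, NoZeroSMulDivisors ℤ (E1R ℤ K p q)) :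
    Module.IsTorsionFree ℤ (Homology (dvM K)) := by
  refine Module.isTorsionFree_iff_smul_eq_zero.mpr fun n x hx => ?_
  by_cases hn : n = 0
  · exact .inl hn
  refine .inr ?_
  obtain ⟨⟨z, hz⟩, rfl⟩ := cls_surjective _ x
  rw [← map_smul, cls_eq_zero_iff] at hx
  obtain ⟨y, hy⟩ := hx
  change dvM K y = n • z at hy
  have key (i : ℤ × ℤ) : ∃ u, dvRL ℤ K u = part K i (ext₀ K z) := by
    obtain ⟨p, q⟩ := i
    have hc : part K (p, q) (ext₀ K z) ∈ Z1R ℤ K p q := by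
      refine ⟨part_mem _ _, ?_⟩
      have := dvRL_part (K := K) (ext₀ K z) p (q + 1)
      rw [add_sub_cancel_right] at this
      exact this.trans (by rw [← ext₀_dvM, LinearMap.mem_ker.mp hz, map_zero, map_zero])
    let mk := ((B1R ℤ K p q).submoduleOf (Z1R ℤ K p q)).mkQ
    have h0 : n • mk ⟨_, hc⟩ = 0 := by
      rw [← map_smul]
      refine (Submodule.Quotient.mk_eq_zero _).mpr
        ⟨⟨part K (p, q - 1) (ext₀ K y), part_mem _ _, ?_⟩, (n • (⟨_, hc⟩ : Z1R ℤ K p q)).2.1⟩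
      rw [dvRL_part, ← ext₀_dvM, hy, map_smul, map_smul]
      rfl
    have h1 := ((h p q).eq_zero_or_eq_zero_of_smul_eq_zero h0).resolve_left hn
    obtain ⟨⟨u, _, hu⟩, _⟩ := (Submodule.Quotient.mk_eq_zero _).mp h1
    exact ⟨u, hu⟩
  choose u hu using key
  obtain ⟨S, hS⟩ := exists_sum_part K
  refine cls_eq_zero_iff.mpr ⟨res K (∑ i ∈ S, u i), ?_⟩
  rw [dvM_res, map_sum, sum_congr rfl fun i _ => hu i, hS, res_ext₀]

theorem isTorsionFree_totalHHR (h : ∀ p q : ℤ, NoZeroSMulDivisors ℤ (HHR ℤ K p q)) :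
    Module.IsTorsionFree ℤ (TotalHHR K) :=
  (splitting_HHR K).isTorsionFree fun i => Module.isTorsionFree_iff_smul_eq_zero.mpr
    fun _ _ hx => (h i.1 i.2).eq_zero_or_eq_zero_of_smul_eq_zero hx

theorem mem_NgrR_joinEquiv (hdisj : Disjoint K.verts L.verts) {i j : ℤ × ℤ} {a b : Pr → ℤ}
    (ha : a ∈ NgrR ℤ K i.1 i.2) (hb : b ∈ NgrR ℤ L j.1 j.2) :
    ext₀ (K.join L) (joinEquiv hdisj (res K a ⊗ₜ res L b)) ∈
      NgrR ℤ (K.join L) (i + j + 1).1 (i + j + 1).2 := by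
  rw [joinEquiv_tmul, ext₀_res_of_mem ha, ext₀_res_of_mem hb]
  refine mem_NgrR_iff.mpr fun z hz => ?_
  by_cases h : (K.join L).IsPair z
  · refine ⟨h, ?_⟩
    rw [ext₀_res_apply _ h, joinFun] at hz
    have hab := right_ne_zero_of_mul hz
    obtain ⟨hx, hi⟩ := mem_NgrR_iff.mp ha _ (left_ne_zero_of_mul hab)
    obtain ⟨hy, hj⟩ := mem_NgrR_iff.mp hb _ (right_ne_zero_of_mul hab)
    have hd := disjoint_of_isPair hdisj hx hy
    have h1 := card_union_of_disjoint (hd.mono hx.1 hy.1)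
    have h2 := card_union_of_disjoint hd
    rw [← unionPair_inter_sdiff K.verts z]
    simp only [bideg, Prod.ext_iff, unionPair, Prod.fst_add, Prod.snd_add, Prod.fst_one,
      Prod.snd_one] at hi hj ⊢
    omega
  · exact absurd (ext₀_apply_of_not _ h) hz

theorem exists_totalHHR_equiv (hdisj : Disjoint K.verts L.verts)
    (hE : ∀ p q : ℤ, NoZeroSMulDivisors ℤ (E1R ℤ K p q))
    (hH : (∀ p q : ℤ, NoZeroSMulDivisors ℤ (HHR ℤ K p q)) ∨
      (∀ p q : ℤ, NoZeroSMulDivisors ℤ (HHR ℤ L p q))) :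
    ∃ Φ : TotalHHR K ⊗[ℤ] TotalHHR L ≃ₗ[ℤ] TotalHHR (K.join L),
      ∀ i j a b, ∃ c, incHHR (K.join L) (i + j + 1) c = Φ (incHHR K i a ⊗ₜ incHHR L j b) := by
  have := isTorsionFree_homology_dvM hE
  obtain ⟨Φ, hΦ⟩ := exists_secondPage_kunneth (signM_comp_signM K) (signM_comp_dvM K)
    (signM_comp_dhM K) (dvM_comp_dvM K) (dhM_comp_dhM K) (dhM_comp_dvM K) (dvM_comp_dvM L)
    (dhM_comp_dhM L) (dhM_comp_dvM L) (hH.imp isTorsionFree_totalHHR isTorsionFree_totalHHR)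
  let Ψ := secondPageCongr (joinEquiv hdisj) (joinEquiv_comp_dvM hdisj) (joinEquiv_comp_dhM hdisj)
  refine ⟨Φ ≪≫ₗ Ψ, fun i j a b => ⟨projHHR (K.join L) (i + j + 1)
    (Ψ (Φ (incHHR K i a ⊗ₜ incHHR L j b))), ?_⟩⟩
  obtain ⟨a, rfl⟩ := clsHHR_surjective _ _ _ a
  obtain ⟨b, rfl⟩ := clsHHR_surjective _ _ _ b
  have h := mem_NgrR_joinEquiv hdisj a.2.1.1 b.2.1.1
  have h' := hΦ ⟨res K a, res_mem_secondCycles a.2⟩ ⟨res L b, res_mem_secondCycles b.2⟩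
  change incHHR _ _ (projHHR _ _ (Ψ (Φ (cls₂ _ _ ⟨res K a, _⟩ ⊗ₜ cls₂ _ _ ⟨res L b, _⟩)))) =
    Ψ (Φ (cls₂ _ _ ⟨res K a, _⟩ ⊗ₜ cls₂ _ _ ⟨res L b, _⟩))
  rw [h']
  refine congrArg (cls₂ (dvM (K.join L)) (dhM (K.join L))) (Subtype.ext ?_)
  change res _ (part _ _ (ext₀ _ (joinEquiv hdisj (res K a ⊗ₜ res L b)))) =
    joinEquiv hdisj (res K a ⊗ₜ res L b)
  rw [part_eq_self h, res_ext₀]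

theorem join_comm (K L : SC) : K.join L = L.join K := by
  have : (K.join L).faces = (L.join K).faces := by
    ext s
    simp only [join, mem_image, mem_product, Prod.exists]
    exact ⟨fun ⟨a, b, h, hs⟩ => ⟨b, a, h.symm, (union_comm b a).trans hs⟩,
      fun ⟨a, b, h, hs⟩ => ⟨b, a, h.symm, (union_comm b a).trans hs⟩⟩
  cases h : K.join L
  cases h' : L.join K
  simp_all

theorem exists_totalHHR_equiv' (hdisj : Disjoint K.verts L.verts)
    (hE : (∀ p q : ℤ, NoZeroSMulDivisors ℤ (E1R ℤ K p q)) ∨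
      (∀ p q : ℤ, NoZeroSMulDivisors ℤ (E1R ℤ L p q)))
    (hH : (∀ p q : ℤ, NoZeroSMulDivisors ℤ (HHR ℤ K p q)) ∨
      (∀ p q : ℤ, NoZeroSMulDivisors ℤ (HHR ℤ L p q))) :
    ∃ Φ : TotalHHR K ⊗[ℤ] TotalHHR L ≃ₗ[ℤ] TotalHHR (K.join L),
      ∀ i j a b, ∃ c, incHHR (K.join L) (i + j + 1) c = Φ (incHHR K i a ⊗ₜ incHHR L j b) := by
  obtain hE | hE := hE
  · exact exists_totalHHR_equiv hdisj hE hH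
  · obtain ⟨Φ, hΦ⟩ := exists_totalHHR_equiv hdisj.symm hE hH.symm
    rw [join_comm K L]
    refine ⟨TensorProduct.comm ℤ _ _ ≪≫ₗ Φ, fun i j a b => ?_⟩
    rw [add_comm i j]
    exact hΦ j i b a

theorem nonempty_HHR_join_equiv (hdisj : Disjoint K.verts L.verts)
    (hE : (∀ p q : ℤ, NoZeroSMulDivisors ℤ (E1R ℤ K p q)) ∨
      (∀ p q : ℤ, NoZeroSMulDivisors ℤ (E1R ℤ L p q)))
    (hH : (∀ p q : ℤ, NoZeroSMulDivisors ℤ (HHR ℤ K p q)) ∨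
      (∀ p q : ℤ, NoZeroSMulDivisors ℤ (HHR ℤ L p q))) (p q : ℤ) :
    Nonempty ((⨁ x : {x : (ℤ × ℤ) × ℤ × ℤ // x.1.1 + x.2.1 = p ∧ x.1.2 + x.2.2 = q},
      HHR ℤ K x.val.1.1 x.val.1.2 ⊗[ℤ] HHR ℤ L x.val.2.1 x.val.2.2) ≃ₗ[ℤ]
        HHR ℤ (K.join L) (p + 1) (q + 1)) := by
  obtain ⟨Φ, hΦ⟩ := exists_totalHHR_equiv' hdisj hE hH
  have hJ := splitting_HHR (K.join L)
  refine nonempty_directSum_equiv (splitting_HHR K) (splitting_HHR L)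
    (incT := incHHR (K.join L) (p + 1, q + 1)) (prT := projHHR (K.join L) (p + 1, q + 1))
    (hJ.pr_inc_self (p + 1, q + 1)) Φ _ (fun i j hij a b => ?_) (fun i j hij a b => ?_)
  · obtain ⟨c, hc⟩ := hΦ i j a b
    have hij : i + j + 1 = (p + 1, q + 1) := Prod.ext (by simp [hij.1]) (by simp [hij.2])
    rw [← hc]
    generalize i + j + 1 = k at hij c
    subst hij
    rw [hJ.pr_inc_self (p + 1, q + 1)]
  · obtain ⟨c, hc⟩ := hΦ i j a b
    rw [← hc]
    refine hJ.pr_inc_of_ne _ (p + 1, q + 1) (fun h => hij ?_) c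
    simpa [Prod.ext_iff] using h

end SC

set_option synthInstance.maxHeartbeats 1000000 in
/-- Künneth theorem for the join: if one of `Ẽ₁(K), Ẽ₁(L)` is
torsion free and one of `𝓗̃(K), 𝓗̃(L)` is torsion free, then
`Σ⁻¹𝓗̃^{*,*}(K*L) ≅ 𝓗̃^{*,*}(K) ⊗ 𝓗̃^{*,*}(L)` as bigraded groups. -/
theorem HHR_join_kunneth (K L : SC) (hdisj : Disjoint K.verts L.verts)
    (hK : ∅ ∈ K.faces) (hL : ∅ ∈ L.faces)
    (hE1 : (∀ p q : ℤ, NoZeroSMulDivisors ℤ (SC.E1R ℤ K p q)) ∨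
      (∀ p q : ℤ, NoZeroSMulDivisors ℤ (SC.E1R ℤ L p q)))
    (hHH : (∀ p q : ℤ, NoZeroSMulDivisors ℤ (SC.HHR ℤ K p q)) ∨
      (∀ p q : ℤ, NoZeroSMulDivisors ℤ (SC.HHR ℤ L p q))) :
    ∀ p q : ℤ, Nonempty (SC.HHR ℤ (K.join L) (p + 1) (q + 1) ≃+
      DirectSum {x : (ℤ × ℤ) × ℤ × ℤ // x.1.1 + x.2.1 = p ∧ x.1.2 + x.2.2 = q}
        fun x => TensorProduct ℤ (SC.HHR ℤ K x.val.1.1 x.val.1.2)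
          (SC.HHR ℤ L x.val.2.1 x.val.2.2)) := by
  intro p q
  obtain ⟨e⟩ := SC.nonempty_HHR_join_equiv hdisj hE1 hHH p q
  exact ⟨e.toAddEquiv.symm⟩
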